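/- arXiv:1611.04544 — 3 statements merged into one kernel-verified Lean document; each statement's English description precedes it below -/
import Mathlib

section
/- Let M be a graded module over R = k[x,y,z] generated in the m consecutive degrees b, b+1, …, b+m−1 for some m ≥ 1, and let L be a linear form in R. If j ≥ m and the multiplication map ×L^j : [M]_b → [M]_{b+j} is surjective, then ×L^j : [M]_{b+i} → [M]_{b+i+j} is surjective for all i ≥ 0. -/
open MvPolynomial

noncomputable section

/-- The polynomial ring `R = k[x,y,z]`. -/
abbrev R3 (K : Type) [Field K] : Type := MvPolynomial (Fin 3) K

/-- The linear form with coefficient vector `v`. -/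
def linForm (K : Type) [Field K] (v : Fin 3 → K) : R3 K :=
  ∑ t : Fin 3, MvPolynomial.C (v t) * MvPolynomial.X t

/-- `P` holds for general tuples of `m` coefficient vectors in `k^3`: there is a nonempty
Zariski-open subset of `(k^3)^m` (the complement of the zero locus of a nonzero polynomial
`g`; over an infinite field every nonempty open set contains such a basic open set) on
which `P` holds. -/
def GenericTuples (K : Type) [Field K] (m : ℕ) (P : (Fin m → Fin 3 → K) → Prop) : Prop :=
  ∃ g : MvPolynomial (Fin m × Fin 3) K, g ≠ 0 ∧
    ∀ c : Fin m → Fin 3 → K, MvPolynomial.eval (fun p => c p.1 p.2) g ≠ 0 → P c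

/-- The degree-`d` graded component `[R/I]_d` of `R/I`, as a `K`-submodule of `R ⧸ I`. -/
def quotComp (K : Type) [Field K] (I : Ideal (R3 K)) (d : ℕ) :
    Submodule K ((R3 K) ⧸ I) :=
  (MvPolynomial.homogeneousSubmodule (Fin 3) K d).map (Ideal.Quotient.mkₐ K I).toLinearMap

/-- The Hilbert function of `R/I`: `hilb K I d = dim_K [R/I]_d`. -/
def hilb (K : Type) [Field K] (I : Ideal (R3 K)) (d : ℕ) : ℕ :=
  Module.finrank K ↥(quotComp K I d)

/-- Multiplication `×L^j : [R/I]_i → [R/I]_{i+j}` has maximal rank: it is injective or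
surjective.  (Indexing by the domain degree `i : ℕ` covers all integer degrees, since in
degrees where the domain `[R/I]_{d-j}` would have negative index it is `0` and the map is
trivially injective.) -/
def mulMaxRank (K : Type) [Field K] (I : Ideal (R3 K)) (L : R3 K) (j i : ℕ) : Prop :=
  (∀ u ∈ quotComp K I i, Ideal.Quotient.mk I L ^ j * u = 0 → u = 0) ∨
  (∀ v ∈ quotComp K I (i + j), ∃ u ∈ quotComp K I i, Ideal.Quotient.mk I L ^ j * u = v)

open DirectSum in
/-- If a module is generated by a set `S`, and for each monomial `f` and each `x ∈ S` the
degree-`d` part of `f • x` lies in the additive submonoid `T`, then the degree-`d` part of every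
element lies in `T`. -/
theorem decompose_mem_of_span_eq_top {K : Type} [Field K] {M : Type} [AddCommGroup M]
    [Module (R3 K) M] [Module K M] (ℳ : ℤ → Submodule K M) [Decomposition ℳ] {S : Set M}
    (hS : Submodule.span (R3 K) S = ⊤) (T : AddSubmonoid M) (d : ℤ)
    (h : ∀ (s : Fin 3 →₀ ℕ) (c : K), ∀ x ∈ S,
      (decompose ℳ (monomial s c • x) d : M) ∈ T) (y : M) :
    (decompose ℳ y d : M) ∈ T := by
  have hy : y ∈ Submodule.span (R3 K) S := hS ▸ Submodule.mem_top
  induction hy using Submodule.closure_induction with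
  | zero => simp
  | add x y _ _ hx hy =>
    simpa using add_mem hx hy
  | smul_mem f x hx =>
    induction f using MvPolynomial.induction_on' with
    | monomial s c => exact h s c x hx
    | add f g hf hg =>
      rw [add_smul, decompose_add, DirectSum.add_apply, Submodule.coe_add]
      exact add_mem hf hg

/-- Let `M` be a graded module over `R = k[x,y,z]` (with graded components
`ℳ d`, `d : ℤ`, forming an internal direct sum and satisfying `R_i • ℳ d ⊆ ℳ (d+i)`),
generated in the `m` consecutive degrees `b, b+1, …, b+m-1` for some `m ≥ 1`, and let `L`
be a linear form.  If `j ≥ m` and `×L^j : [M]_b → [M]_{b+j}` is surjective, then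
`×L^j : [M]_{b+i} → [M]_{b+i+j}` is surjective for all `i ≥ 0`. -/
theorem stmt9 (K : Type) [Field K]
    (M : Type) [AddCommGroup M] [Module (R3 K) M] [Module K M]
    [IsScalarTower K (R3 K) M]
    (ℳ : ℤ → Submodule K M)
    (hdecomp : DirectSum.IsInternal ℳ)
    (hsmul : ∀ (i : ℕ) (d : ℤ) (f : R3 K),
      f ∈ MvPolynomial.homogeneousSubmodule (Fin 3) K i →
      ∀ x ∈ ℳ d, f • x ∈ ℳ (d + i))
    (b : ℤ) (m : ℕ) (hm : 1 ≤ m)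
    -- `M` is generated, as an `R`-module, in degrees `b, b+1, …, b+m-1`
    (hgen : Submodule.span (R3 K) (⋃ i ∈ Finset.range m, ((ℳ (b + i) : Submodule K M) : Set M)) = ⊤)
    (L : R3 K) (hL1 : L ∈ MvPolynomial.homogeneousSubmodule (Fin 3) K 1) (hL0 : L ≠ 0)
    (j : ℕ) (hj : m ≤ j)
    (hsurj : ∀ y ∈ ℳ (b + j), ∃ x ∈ ℳ b, L ^ j • x = y) :
    ∀ i : ℕ, ∀ y ∈ ℳ (b + i + j), ∃ x ∈ ℳ (b + i), L ^ j • x = y := by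
  classical
  intro i y hy
  let := hdecomp.chooseDecomposition
  let T : AddSubmonoid M := (ℳ (b + i)).toAddSubmonoid.map (DistribSMul.toAddMonoidHom M (L ^ j))
  suffices hT : y ∈ T from hT
  rw [← DirectSum.decompose_of_mem_same ℳ hy]
  refine decompose_mem_of_span_eq_top ℳ hgen T _ (fun s c x hx => ?_) y
  simp only [Set.mem_iUnion, Finset.mem_range] at hx
  obtain ⟨a, ha, hx⟩ := hx
  have hmem : monomial s c • x ∈ ℳ (b + a + s.degree) :=
    hsmul _ _ _ (isHomogeneous_monomial c rfl) x hx
  by_cases hd : b + a + s.degree = b + i + j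
  · rw [DirectSum.decompose_of_mem_same ℳ (hd ▸ hmem)]
    obtain ⟨t, hts, ht⟩ := s.exists_le_degree_eq i (by lia)
    obtain ⟨u, rfl⟩ := exists_add_of_le hts
    rw [map_add] at hd
    have hu : monomial u c • x ∈ ℳ (b + j) := by
      convert hsmul u.degree _ _ (isHomogeneous_monomial c rfl) x hx using 2
      push_cast at hd
      lia
    obtain ⟨x', hx', hLx'⟩ := hsurj _ hu
    refine ⟨monomial t (1 : K) • x', hsmul i b _ (isHomogeneous_monomial 1 ht) x' hx', ?_⟩
    change L ^ j • monomial t (1 : K) • x' = _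
    rw [smul_comm, hLx', smul_smul, monomial_mul, one_mul]
  · rw [DirectSum.decompose_of_mem_ne ℳ hmem hd]
    exact zero_mem T
end
end

section
/- Let k ≥ 3 and j ≥ 2. For general linear forms L_1,…,L_4, L in R = k[x,y,z], set I = (L_1^k,…,L_4^k) and let h denote the Hilbert function of R/I. Define a = max{ d : h(d−j) ≤ h(d) } and b = min{ d : h(d−j) ≥ h(d) }. If ×L^j : [R/I]_{a−j} → [R/I]_a is injective and ×L^j : [R/I]_{b−j} → [R/I]_b is surjective, then ×L^j : [R/I]_{d−j} → [R/I]_d has maximal rank for every integer d. -/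
open MvPolynomial

noncomputable section

namespace FourPowers

section Univariate

open Polynomial (degreeLT mem_degreeLT)

variable {K : Type} [Field K]

/-- The polynomials of the form `X ^ k * a + (1 - X) ^ k * b` with `a` and `b` of degree less
than `l - k`: the dehomogenized degree `l - 1` component of the ideal `(x ^ k, (t - x) ^ k)`. -/
def binaryComp (K : Type) [Field K] (k l : ℕ) : Submodule K (Polynomial K) :=
  (degreeLT K (l - k)).map (LinearMap.mulLeft K (Polynomial.X ^ k)) ⊔
    (degreeLT K (l - k)).map (LinearMap.mulLeft K ((1 - Polynomial.X) ^ k))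

theorem mem_binaryComp {k l : ℕ} {p : Polynomial K} :
    p ∈ binaryComp K k l ↔ ∃ a ∈ degreeLT K (l - k), ∃ b ∈ degreeLT K (l - k),
      Polynomial.X ^ k * a + (1 - Polynomial.X) ^ k * b = p := by
  simp [binaryComp, Submodule.mem_sup]

theorem mul_mem_degreeLT {p q : Polynomial K} {m n r : ℕ} (hp : p ∈ degreeLT K m)
    (hq : q ∈ degreeLT K n) (h : m + n ≤ r + 1) : p * q ∈ degreeLT K r := by
  rcases eq_or_ne p 0 with rfl | hp0
  · simp
  rcases eq_or_ne q 0 with rfl | hq0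
  · simp
  rw [mem_degreeLT, ← Polynomial.natDegree_lt_iff_degree_lt ‹_›] at hp hq
  rw [mem_degreeLT, ← Polynomial.natDegree_lt_iff_degree_lt (mul_ne_zero hp0 hq0),
    Polynomial.natDegree_mul hp0 hq0]
  omega

theorem X_mul_mem_degreeLT {p : Polynomial K} {n : ℕ} (hp : p ∈ degreeLT K n) :
    Polynomial.X * p ∈ degreeLT K (n + 1) :=
  mul_mem_degreeLT (m := 2) (by rw [mem_degreeLT, Polynomial.degree_X]; norm_num) hp (by omega)

theorem mem_degreeLT_of_X_mul {p : Polynomial K} {n : ℕ}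
    (hp : Polynomial.X * p ∈ degreeLT K (n + 1)) : p ∈ degreeLT K n := by
  rcases eq_or_ne p 0 with rfl | hp0
  · simp
  rw [mem_degreeLT, ← Polynomial.natDegree_lt_iff_degree_lt (by simpa using hp0),
    Polynomial.natDegree_X_mul hp0] at hp
  rw [mem_degreeLT, ← Polynomial.natDegree_lt_iff_degree_lt hp0]
  omega

theorem natDegree_one_sub_X_pow (k : ℕ) :
    ((1 - Polynomial.X : Polynomial K) ^ k).natDegree = k := by
  have : (1 - Polynomial.X : Polynomial K) = -(Polynomial.X - Polynomial.C 1) := by simp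
  rw [Polynomial.natDegree_pow, this, Polynomial.natDegree_neg, Polynomial.natDegree_X_sub_C,
    mul_one]

theorem isCoprime_X_pow_one_sub_X_pow (k : ℕ) :
    IsCoprime ((Polynomial.X : Polynomial K) ^ k) ((1 - Polynomial.X) ^ k) :=
  IsCoprime.pow ⟨1, 1, by ring⟩

theorem binaryComp_mono {k l m : ℕ} (h : l ≤ m) : binaryComp K k l ≤ binaryComp K k m :=
  sup_le_sup (Submodule.map_mono (Polynomial.degreeLT_mono (Nat.sub_le_sub_right h k)))
    (Submodule.map_mono (Polynomial.degreeLT_mono (Nat.sub_le_sub_right h k)))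

theorem degreeLT_eq_bot_of_eq_zero {n : ℕ} (h : n = 0) {p : Polynomial K}
    (hp : p ∈ degreeLT K n) : p = 0 := by
  subst h
  simpa [mem_degreeLT, Polynomial.degree_lt_iff_coeff_zero, Polynomial.ext_iff] using hp

theorem binaryComp_le_degreeLT {k l : ℕ} : binaryComp K k l ≤ degreeLT K l := by
  intro p hp
  obtain ⟨a, ha, b, hb, rfl⟩ := mem_binaryComp.1 hp
  rcases le_total l k with h | h
  · rw [degreeLT_eq_bot_of_eq_zero (by omega) ha, degreeLT_eq_bot_of_eq_zero (by omega) hb]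
    simp
  · refine add_mem (mul_mem_degreeLT (m := k + 1) ?_ ha (by omega))
      (mul_mem_degreeLT (m := k + 1) ?_ hb (by omega))
    · rw [mem_degreeLT, Polynomial.degree_X_pow]; exact_mod_cast Nat.lt_succ_self k
    · rw [mem_degreeLT]
      refine Polynomial.degree_le_natDegree.trans_lt ?_
      rw [natDegree_one_sub_X_pow]; exact_mod_cast Nat.lt_succ_self k

theorem eq_zero_of_mem_binaryComp {k l : ℕ} (h : l ≤ k) {p : Polynomial K}
    (hp : p ∈ binaryComp K k l) : p = 0 := by
  obtain ⟨a, ha, b, hb, rfl⟩ := mem_binaryComp.1 hp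
  rw [degreeLT_eq_bot_of_eq_zero (by omega) ha, degreeLT_eq_bot_of_eq_zero (by omega) hb]
  simp

theorem mul_mem_binaryComp {k l j m : ℕ} {p v : Polynomial K} (hp : p ∈ degreeLT K j)
    (hv : v ∈ binaryComp K k l) (h : j + l ≤ m + 1) : p * v ∈ binaryComp K k m := by
  rcases le_total l k with hl | hl
  · simp [eq_zero_of_mem_binaryComp hl hv]
  rcases Nat.eq_zero_or_pos j with rfl | hj
  · simp [degreeLT_eq_bot_of_eq_zero rfl hp]
  obtain ⟨a, ha, b, hb, rfl⟩ := mem_binaryComp.1 hv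
  exact mem_binaryComp.2 ⟨p * a, mul_mem_degreeLT hp ha (by omega), p * b,
    mul_mem_degreeLT hp hb (by omega), by ring⟩

theorem X_mem_degreeLT : (Polynomial.X : Polynomial K) ∈ degreeLT K 2 := by
  rw [mem_degreeLT, Polynomial.degree_X]; norm_num

theorem X_mul_mem_binaryComp {k l : ℕ} {v : Polynomial K} (hv : v ∈ binaryComp K k l) :
    Polynomial.X * v ∈ binaryComp K k (l + 1) :=
  mul_mem_binaryComp X_mem_degreeLT hv (by omega)

theorem exists_mem_binaryComp (k : ℕ) (p : Polynomial K) : ∃ l, p ∈ binaryComp K k (l + 1) := by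
  obtain ⟨u, w, h⟩ := isCoprime_X_pow_one_sub_X_pow (K := K) k
  refine ⟨(u * p).natDegree + (w * p).natDegree + k, mem_binaryComp.2
    ⟨u * p, ?_, w * p, ?_, by linear_combination p * h⟩⟩ <;>
  · rw [mem_degreeLT]
    refine Polynomial.degree_le_natDegree.trans_lt ?_
    exact_mod_cast (by omega)

/-- The least `β` for which `binaryComp K k (β + 1)` contains a polynomial of degree `d`. -/
def orderAt (K : Type) [Field K] (k d : ℕ) : ℕ :=
  sInf {β | ∃ e ∈ binaryComp K k (β + 1), e.Monic ∧ e.natDegree = d}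

theorem exists_monic_mem (k d : ℕ) :
    ∃ e ∈ binaryComp K k (orderAt K k d + 1), e.Monic ∧ e.natDegree = d := by
  have : {β | ∃ e ∈ binaryComp K k (β + 1), e.Monic ∧ e.natDegree = d}.Nonempty := by
    obtain ⟨l, hl⟩ := exists_mem_binaryComp (K := K) k (Polynomial.X ^ d)
    exact ⟨l, _, hl, Polynomial.monic_X_pow d, Polynomial.natDegree_X_pow d⟩
  exact Nat.sInf_mem this

/-- A monic polynomial of degree `d` in `binaryComp K k (orderAt K k d + 1)`. -/
def lead (K : Type) [Field K] (k d : ℕ) : Polynomial K := (exists_monic_mem (K := K) k d).choose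

theorem lead_mem (k d : ℕ) : lead K k d ∈ binaryComp K k (orderAt K k d + 1) :=
  (exists_monic_mem k d).choose_spec.1

theorem lead_monic (k d : ℕ) : (lead K k d).Monic := (exists_monic_mem k d).choose_spec.2.1

theorem natDegree_lead (k d : ℕ) : (lead K k d).natDegree = d :=
  (exists_monic_mem k d).choose_spec.2.2

theorem orderAt_lt {k l : ℕ} {w : Polynomial K} (hw : w ∈ binaryComp K k l) (h0 : w ≠ 0) :
    orderAt K k w.natDegree + 1 ≤ l := by
  have hl : 1 ≤ l := by
    by_contra h
    exact h0 (eq_zero_of_mem_binaryComp (by omega) hw)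
  have : orderAt K k w.natDegree ≤ l - 1 := by
    refine Nat.sInf_le ⟨Polynomial.C w.leadingCoeff⁻¹ * w, ?_, ?_, ?_⟩
    · rw [Nat.sub_add_cancel hl, ← Polynomial.smul_eq_C_mul]
      exact Submodule.smul_mem _ _ hw
    · rw [mul_comm]; exact Polynomial.monic_mul_leadingCoeff_inv h0
    · exact Polynomial.natDegree_C_mul (by simpa using h0)
  omega

theorem le_orderAt (k d : ℕ) : d ≤ orderAt K k d := by
  have h := binaryComp_le_degreeLT (lead_mem (K := K) k d)
  rw [mem_degreeLT, ← Polynomial.natDegree_lt_iff_degree_lt (lead_monic k d).ne_zero,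
    natDegree_lead] at h
  omega

theorem orderAt_succ_le (k d : ℕ) : orderAt K k (d + 1) ≤ orderAt K k d + 1 := by
  have h := orderAt_lt (X_mul_mem_binaryComp (lead_mem (K := K) k d))
    (mul_ne_zero Polynomial.X_ne_zero (lead_monic k d).ne_zero)
  rw [Polynomial.natDegree_X_mul (lead_monic k d).ne_zero, natDegree_lead] at h
  omega

theorem orderAt_add_le (k d n : ℕ) : orderAt K k (d + n) ≤ orderAt K k d + n := by
  induction n with
  | zero => simp
  | succ n ih => have := orderAt_succ_le (K := K) k (d + n); rw [← add_assoc]; omega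

theorem orderAt_add_le_of_le {k d s : ℕ} (h : d ≤ s) :
    orderAt K k s + d ≤ orderAt K k d + s := by
  have := orderAt_add_le (K := K) k d (s - d)
  rw [Nat.add_sub_cancel' h] at this
  omega

/-- Subtracting the leading term with respect to the basis `lead K k`. -/
theorem natDegree_sub_lead_lt {y : Polynomial K} (k : ℕ) {s : ℕ} (hy : y ∈ degreeLT K (s + 1)) :
    y - Polynomial.C (y.coeff s) * lead K k s ∈ degreeLT K s := by
  rw [mem_degreeLT, Polynomial.degree_lt_iff_coeff_zero] at hy ⊢
  intro m hm
  rcases hm.eq_or_lt with rfl | hm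
  · have : (lead K k s).coeff s = 1 := by
      have := (lead_monic (K := K) k s).coeff_natDegree
      rwa [natDegree_lead] at this
    simp [this]
  · have : (lead K k s).coeff m = 0 :=
      Polynomial.coeff_eq_zero_of_natDegree_lt (by rw [natDegree_lead]; exact hm)
    rw [Polynomial.coeff_sub, hy m (by exact_mod_cast hm), Polynomial.coeff_C_mul, this]
    simp

theorem exists_orderAt_eq {k l n : ℕ} {y : Polynomial K} (hy : y ∈ binaryComp K k (l + 1))
    (hy' : y ∉ binaryComp K k l) (hn : y ∈ degreeLT K n) : ∃ d < n, orderAt K k d = l := by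
  induction n generalizing y with
  | zero => exact absurd (by rw [degreeLT_eq_bot_of_eq_zero rfl hn]; exact zero_mem _) hy'
  | succ n ih =>
    by_cases hc : y.coeff n = 0
    · obtain ⟨d, hd, h⟩ := ih hy hy' (by simpa [hc] using natDegree_sub_lead_lt k hn)
      exact ⟨d, by omega, h⟩
    have h0 : y ≠ 0 := by rintro rfl; simp at hc
    have hdeg : y.natDegree = n := by
      refine le_antisymm ?_ (Polynomial.le_natDegree_of_ne_zero hc)
      rw [mem_degreeLT, ← Polynomial.natDegree_lt_iff_degree_lt h0] at hn
      omega
    have hlt := orderAt_lt hy h0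
    rw [hdeg] at hlt
    by_cases hl : orderAt K k n = l
    · exact ⟨n, by omega, hl⟩
    have hmem : Polynomial.C (y.coeff n) * lead K k n ∈ binaryComp K k l := by
      rw [← Polynomial.smul_eq_C_mul]
      exact Submodule.smul_mem _ _ (binaryComp_mono (by omega) (lead_mem k n))
    obtain ⟨d, hd, h⟩ := ih (sub_mem hy (binaryComp_mono (by omega) hmem))
      (fun h => hy' (by simpa using add_mem h hmem)) (natDegree_sub_lead_lt k hn)
    exact ⟨d, by omega, h⟩

theorem mem_binaryComp_of_X_mul_mem {k l : ℕ} (hl : l + 2 ≤ 2 * k)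
    {p : Polynomial K} (hp : p ∈ binaryComp K k (l + 1)) (hX : Polynomial.X * p ∈ binaryComp K k (l + 1)) :
    p ∈ binaryComp K k l := by
  rcases Nat.lt_or_ge l k with hlk | hlk
  · by_cases h1 : l + 1 ≤ k
    · rw [eq_zero_of_mem_binaryComp h1 hp]; exact zero_mem _
    · omega
  obtain ⟨a, ha, b, hb, rfl⟩ := mem_binaryComp.1 hp
  obtain ⟨a', ha', b', hb', h⟩ := mem_binaryComp.1 hX
  rw [show l + 1 - k = (l - k) + 1 by omega] at ha ha' hb hb'
  have key : Polynomial.X ^ k * (Polynomial.X * a - a') =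
      (1 - Polynomial.X) ^ k * (b' - Polynomial.X * b) := by linear_combination -h
  have hlt : b' - Polynomial.X * b ∈ degreeLT K k :=
    sub_mem (Polynomial.degreeLT_mono (by omega) hb')
      (Polynomial.degreeLT_mono (by omega) (X_mul_mem_degreeLT hb))
  have hdvd : Polynomial.X ^ k ∣ b' - Polynomial.X * b :=
    (isCoprime_X_pow_one_sub_X_pow k).dvd_of_dvd_mul_left ⟨_, key.symm⟩
  have hb0 : b' - Polynomial.X * b = 0 :=
    Polynomial.eq_zero_of_dvd_of_degree_lt hdvd (by simpa [mem_degreeLT] using hlt)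
  have ha0 : Polynomial.X * a - a' = 0 := by
    rw [hb0, mul_zero] at key
    simpa using key
  refine mem_binaryComp.2 ⟨a, mem_degreeLT_of_X_mul ?_, b, mem_degreeLT_of_X_mul ?_, rfl⟩
  · rwa [sub_eq_zero.1 ha0]
  · rwa [← sub_eq_zero.1 hb0]

theorem modByMonic_mem_degreeLT {e y : Polynomial K} (he : e.Monic) :
    y %ₘ e ∈ degreeLT K e.natDegree := by
  rw [mem_degreeLT, ← Polynomial.degree_eq_natDegree he.ne_zero]
  exact Polynomial.degree_modByMonic_lt _ he

theorem divByMonic_mem_degreeLT {e y : Polynomial K} {n m : ℕ} (he : e.Monic)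
    (hy : y ∈ degreeLT K n) (h : n ≤ m + e.natDegree) : y /ₘ e ∈ degreeLT K m := by
  rcases eq_or_ne (y /ₘ e) 0 with h0 | h0
  · simp [h0]
  have hy0 : y ≠ 0 := by rintro rfl; simp at h0
  have hd := Polynomial.natDegree_divByMonic y he
  have hle : ¬ y.degree < e.degree := fun hh => h0 ((Polynomial.divByMonic_eq_zero_iff he).2 hh)
  rw [not_lt] at hle
  have hle' := Polynomial.natDegree_le_natDegree hle
  rw [mem_degreeLT, ← Polynomial.natDegree_lt_iff_degree_lt ‹_›] at hy ⊢
  omega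

theorem le_orderAt_add {k s : ℕ} (hs : orderAt K k (s + 1) ≤ orderAt K k s) :
    2 * k ≤ orderAt K k s + s + 1 := by
  by_contra! hlt
  set N := orderAt K k s
  have hmem (j : ℕ) : Polynomial.X ^ j * lead K k s ∈ binaryComp K k (N + j + 1) := by
    induction j with
    | zero => simpa using lead_mem k s
    | succ j ih => rw [pow_succ', mul_assoc]; exact X_mul_mem_binaryComp ih
  have hne (j : ℕ) (hj : j ≤ s + 1) : Polynomial.X ^ j * lead K k s ∉ binaryComp K k (N + j) := by
    induction j with
    | zero =>
      intro h
      have := orderAt_lt (by simpa using h) (lead_monic k s).ne_zero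
      rw [natDegree_lead] at this
      omega
    | succ j ih =>
      intro h
      refine ih (by omega) (mem_binaryComp_of_X_mul_mem (by omega) (hmem j) ?_)
      rwa [← mul_assoc, ← pow_succ']
  have hex (j : Fin (s + 2)) : ∃ d : Fin (s + 1), orderAt K k d = N + j := by
    have hq := Polynomial.modByMonic_add_div (Polynomial.X ^ (j : ℕ) * lead K k s)
      (lead K k (s + 1))
    have hdeg : Polynomial.X ^ (j : ℕ) * lead K k s ∈ degreeLT K (j + (s + 1)) := by
      rw [mem_degreeLT, ← Polynomial.natDegree_lt_iff_degree_lt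
        (mul_ne_zero (pow_ne_zero _ Polynomial.X_ne_zero) (lead_monic k s).ne_zero),
        Polynomial.natDegree_X_pow_mul _ (lead_monic k s).ne_zero, natDegree_lead]
      omega
    have hquot := divByMonic_mem_degreeLT (m := j) (lead_monic k (s + 1)) hdeg
      (by rw [natDegree_lead])
    have hprod := mul_mem_binaryComp (m := N + j) hquot (lead_mem k (s + 1)) (by omega)
    rw [mul_comm] at hprod
    have hrem := modByMonic_mem_degreeLT (y := Polynomial.X ^ (j : ℕ) * lead K k s)
      (lead_monic k (s + 1))
    rw [natDegree_lead] at hrem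
    obtain ⟨d, hd, h⟩ := exists_orderAt_eq (k := k) (l := N + j)
      (y := (Polynomial.X ^ (j : ℕ) * lead K k s) %ₘ lead K k (s + 1))
      (by rw [eq_sub_of_add_eq hq]
          exact sub_mem (hmem j) (binaryComp_mono (by omega) hprod))
      (fun h => hne j (by omega) (by rw [← hq]; exact add_mem h hprod)) hrem
    exact ⟨⟨d, hd⟩, h⟩
  choose f hf using hex
  have hinj : Function.Injective f := by
    intro a b hab
    have ha := hf a
    rw [hab, hf b] at ha
    exact Fin.ext (by omega)
  simpa using Fintype.card_le_of_injective f hinj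

theorem mem_degreeLT_of_mem_sup {k s m : ℕ} (hs : orderAt K k (s + 1) ≤ orderAt K k s)
    {y : Polynomial K} (hy : y ∈ degreeLT K (s + 1))
    (h : y ∈ binaryComp K k (m + 1 - s) ⊔ degreeLT K (m + 1 - orderAt K k s)) :
    y ∈ degreeLT K (m + 1 - orderAt K k s) := by
  obtain ⟨w, hw, z, hz, rfl⟩ := Submodule.mem_sup.1 h
  have hz1 := Polynomial.modByMonic_add_div z (lead K k (s + 1))
  have hle := le_orderAt (K := K) k s
  by_cases hms : orderAt K k s ≤ m + 1
  swap
  · have hz0 := degreeLT_eq_bot_of_eq_zero (by omega) hz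
    rcases eq_or_ne w 0 with rfl | hw0
    · simpa using hz
    subst hz0
    rw [add_zero] at hy
    have h1 := orderAt_lt hw hw0
    rw [mem_degreeLT, ← Polynomial.natDegree_lt_iff_degree_lt hw0] at hy
    have h2 := orderAt_add_le_of_le (K := K) (k := k) (d := w.natDegree) (s := s) (by omega)
    omega
  have hrem := modByMonic_mem_degreeLT (y := z) (lead_monic k (s + 1))
  rw [natDegree_lead] at hrem
  have hquot := divByMonic_mem_degreeLT (m := m - orderAt K k s - s) (lead_monic k (s + 1)) hz
      (by rw [natDegree_lead]; omega)
  have hprod : lead K k (s + 1) * (z /ₘ lead K k (s + 1)) ∈ binaryComp K k (m + 1 - s) := by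
    rcases Nat.lt_or_ge (orderAt K k s + s) m with h | h
    · rw [mul_comm]
      exact mul_mem_binaryComp hquot (lead_mem k (s + 1)) (by omega)
    · rw [degreeLT_eq_bot_of_eq_zero (by omega) hquot, mul_zero]; exact zero_mem _
  have hz' : z %ₘ lead K k (s + 1) ∈ degreeLT K (m + 1 - orderAt K k s) := by
    rw [mem_degreeLT] at hz ⊢
    exact Polynomial.degree_modByMonic_le_left.trans_lt hz
  have hw' : w + lead K k (s + 1) * (z /ₘ lead K k (s + 1)) ∈ binaryComp K k (m + 1 - s) :=
    add_mem hw hprod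
  have hsplit : w + z = (w + lead K k (s + 1) * (z /ₘ lead K k (s + 1))) +
      z %ₘ lead K k (s + 1) := by linear_combination -hz1
  rw [hsplit] at hy ⊢
  refine add_mem ?_ hz'
  rcases eq_or_ne (w + lead K k (s + 1) * (z /ₘ lead K k (s + 1))) 0 with h0 | h0
  · rw [h0]; exact zero_mem _
  have hd := (add_mem_cancel_right hrem).1 hy
  have h1 := orderAt_lt hw' h0
  rw [mem_degreeLT, ← Polynomial.natDegree_lt_iff_degree_lt h0] at hd ⊢
  have h2 := orderAt_add_le_of_le (K := K) (k := k) (s := s)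
    (Nat.lt_succ_iff.1 hd)
  omega

/-- The coefficientwise form of the absence of socle in low degrees. -/
theorem mem_sup_of_socle {k s m : ℕ} (hm : m + 2 ≤ 2 * k) {v : Polynomial K}
    (h1 : v ∈ binaryComp K k (m + 1 - s) ⊔ degreeLT K (m + 1 - orderAt K k s))
    (h2 : Polynomial.X * v ∈
      binaryComp K k (m + 1 - s) ⊔ degreeLT K (m + 1 - orderAt K k s))
    (h3 : v ∈ binaryComp K k (m - s) ⊔ degreeLT K (m + 1 - orderAt K k (s + 1))) :
    v ∈ binaryComp K k (m - s) ⊔ degreeLT K (m - orderAt K k s) := by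
  have hle := le_orderAt (K := K) k s
  by_cases hs : orderAt K k (s + 1) ≤ orderAt K k s
  swap
  · have : orderAt K k (s + 1) = orderAt K k s + 1 := by
      have := orderAt_succ_le (K := K) k s; omega
    rwa [this, Nat.add_sub_add_right] at h3
  obtain ⟨w, hw, z, hz, rfl⟩ := Submodule.mem_sup.1 h3
  have hz1 := Polynomial.modByMonic_add_div z (lead K k (s + 1))
  have hrem := modByMonic_mem_degreeLT (y := z) (lead_monic k (s + 1))
  rw [natDegree_lead] at hrem
  have hle' := le_orderAt (K := K) k (s + 1)
  have hquot := divByMonic_mem_degreeLT (m := m - s - orderAt K k (s + 1)) (lead_monic k (s + 1))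
    hz (by rw [natDegree_lead]; omega)
  have hprod : lead K k (s + 1) * (z /ₘ lead K k (s + 1)) ∈ binaryComp K k (m - s) := by
    rcases Nat.lt_or_ge (m - s) (orderAt K k (s + 1)) with h | h
    · rw [degreeLT_eq_bot_of_eq_zero (by omega) hquot, mul_zero]; exact zero_mem _
    rw [mul_comm]
    exact mul_mem_binaryComp hquot (lead_mem k (s + 1)) (by omega)
  set y := z %ₘ lead K k (s + 1)
  have hw' : w + lead K k (s + 1) * (z /ₘ lead K k (s + 1)) ∈ binaryComp K k (m - s) :=
    add_mem hw hprod
  have hsplit : w + z = (w + lead K k (s + 1) * (z /ₘ lead K k (s + 1))) + y := by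
    linear_combination -hz1
  rw [hsplit] at h1 h2 ⊢
  set w' := w + lead K k (s + 1) * (z /ₘ lead K k (s + 1))
  have hy1 : y ∈ binaryComp K k (m + 1 - s) ⊔ degreeLT K (m + 1 - orderAt K k s) :=
    (add_mem_cancel_left (Submodule.mem_sup_left (binaryComp_mono (by omega) hw'))).1 h1
  refine add_mem (Submodule.mem_sup_left hw') (Submodule.mem_sup_right ?_)
  have hy := mem_degreeLT_of_mem_sup hs hrem hy1
  rcases Nat.lt_or_ge m (orderAt K k s) with hmN | hmN
  · exact Polynomial.degreeLT_mono (by omega) hy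
  by_contra hcon
  have hy0 : y ≠ 0 := by rintro h; rw [h] at hcon; exact hcon (zero_mem _)
  rw [mem_degreeLT, ← Polynomial.natDegree_lt_iff_degree_lt hy0] at hy hcon hrem
  have hI := le_orderAt_add hs
  have hXw : Polynomial.X * w' ∈ binaryComp K k (m + 1 - s) := by
    have := X_mul_mem_binaryComp hw'
    rcases Nat.lt_or_ge m s with h | h
    · rw [eq_zero_of_mem_binaryComp (by omega) hw', mul_zero]; exact zero_mem _
    · rwa [← Nat.sub_add_comm h] at this
  rw [mul_add] at h2
  have hy2 := (add_mem_cancel_left (Submodule.mem_sup_left hXw)).1 h2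
  have hXy : Polynomial.X * y ∈ degreeLT K (s + 1) := by
    rw [mem_degreeLT, ← Polynomial.natDegree_lt_iff_degree_lt
      (mul_ne_zero Polynomial.X_ne_zero hy0), Polynomial.natDegree_X_mul hy0]
    omega
  have := mem_degreeLT_of_mem_sup hs hXy hy2
  rw [mem_degreeLT, ← Polynomial.natDegree_lt_iff_degree_lt
      (mul_ne_zero Polynomial.X_ne_zero hy0), Polynomial.natDegree_X_mul hy0] at this
  omega

end Univariate

section Bivariate

open Polynomial (degreeLT mem_degreeLT)

variable {K : Type} [Field K]

/-- The polynomials in two variables of total degree less than `n`. -/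
def totalDegreeLT (K : Type) [Field K] (n : ℕ) : Submodule K (Polynomial (Polynomial K)) where
  carrier := {w | ∀ b, w.coeff b ∈ degreeLT K (n - b)}
  add_mem' hv hw b := by
    rw [Polynomial.coeff_add]; exact add_mem (hv b) (hw b)
  zero_mem' b := by simp
  smul_mem' c w hw b := by
    rw [Polynomial.coeff_smul]; exact Submodule.smul_mem _ c (hw b)

/-- The product `p(x) q(y)` as a polynomial in `y` over `K[x]`. -/
def tensorMul (p q : Polynomial K) : Polynomial (Polynomial K) :=
  Polynomial.C p * q.map Polynomial.C

theorem tensorMul_add_left (p p' q : Polynomial K) :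
    tensorMul (p + p') q = tensorMul p q + tensorMul p' q := by simp [tensorMul, add_mul]

theorem tensorMul_add_right (p q q' : Polynomial K) :
    tensorMul p (q + q') = tensorMul p q + tensorMul p q' := by simp [tensorMul, mul_add]

theorem tensorMul_C_mul (c : K) (p q : Polynomial K) :
    tensorMul p (Polynomial.C c * q) = tensorMul (Polynomial.C c * p) q := by
  simp only [tensorMul, Polynomial.map_mul, Polynomial.map_C, Polynomial.C_mul]
  ring

theorem coeff_tensorMul (p q : Polynomial K) (b : ℕ) :
    (tensorMul p q).coeff b = p * Polynomial.C (q.coeff b) := by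
  simp [tensorMul, Polynomial.coeff_C_mul]

theorem mul_C_mem_degreeLT {p : Polynomial K} {n : ℕ} (hp : p ∈ degreeLT K n) (c : K) :
    p * Polynomial.C c ∈ degreeLT K n := by
  rw [mul_comm, ← Polynomial.smul_eq_C_mul]
  exact Submodule.smul_mem _ _ hp

theorem tensorMul_mem {p q : Polynomial K} {α β n : ℕ} (hp : p ∈ degreeLT K α)
    (hq : q ∈ degreeLT K β) (h : α + β ≤ n + 1) : tensorMul p q ∈ totalDegreeLT K n := by
  intro b
  rw [coeff_tensorMul]
  rcases Nat.lt_or_ge b β with hb | hb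
  · exact Polynomial.degreeLT_mono (by omega) (mul_C_mem_degreeLT hp _)
  · rw [mem_degreeLT, Polynomial.degree_lt_iff_coeff_zero] at hq
    rw [hq b (by exact_mod_cast hb)]
    simp

/-- The allowed coefficients of `lead K k d` in the dehomogenized ideal. -/
def coeffComp (K : Type) [Field K] (k m d : ℕ) : Submodule K (Polynomial K) :=
  binaryComp K k (m - d) ⊔ degreeLT K (m - orderAt K k d)

theorem eq_zero_of_mem_coeffComp {k m d : ℕ} (h : m ≤ d) {p : Polynomial K}
    (hp : p ∈ coeffComp K k m d) : p = 0 := by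
  have hle := le_orderAt (K := K) k d
  obtain ⟨w, hw, z, hz, rfl⟩ := Submodule.mem_sup.1 hp
  rw [eq_zero_of_mem_binaryComp (by omega) hw, degreeLT_eq_bot_of_eq_zero (by omega) hz, add_zero]

/-- The sums `∑ b_d(x) e_d(y)`, where `e_d` is `lead K k d` and `b_d` lies in
`coeffComp K k m d`. -/
def expansionComp (K : Type) [Field K] (k m : ℕ) : Submodule K (Polynomial (Polynomial K)) where
  carrier := {w | ∃ b : ℕ → Polynomial K, (∀ d, b d ∈ coeffComp K k m d) ∧
    w = ∑ d ∈ Finset.range m, tensorMul (b d) (lead K k d)}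
  add_mem' := by
    rintro _ _ ⟨b, hb, rfl⟩ ⟨b', hb', rfl⟩
    exact ⟨b + b', fun d => add_mem (hb d) (hb' d), by
      simp [tensorMul_add_left, Finset.sum_add_distrib]⟩
  zero_mem' := ⟨0, fun d => zero_mem _, by simp [tensorMul]⟩
  smul_mem' := by
    rintro c _ ⟨b, hb, rfl⟩
    refine ⟨c • b, fun d => Submodule.smul_mem _ c (hb d), ?_⟩
    rw [Finset.smul_sum]
    refine Finset.sum_congr rfl fun d _ => ?_
    simp [tensorMul, ← Polynomial.smul_C]

theorem tensorMul_lead_mem_expansionComp {k m d : ℕ} {b : Polynomial K}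
    (hb : b ∈ coeffComp K k m d) : tensorMul b (lead K k d) ∈ expansionComp K k m := by
  rcases Nat.lt_or_ge d m with h | h
  · refine ⟨fun i => if i = d then b else 0, fun i => ?_, ?_⟩
    · dsimp only
      split_ifs with hi
      · rwa [hi]
      · exact zero_mem _
    · rw [Finset.sum_eq_single d]
      · simp
      · intro i _ hi; simp [hi, tensorMul]
      · intro hd; exact absurd (Finset.mem_range.2 h) hd
  · rw [eq_zero_of_mem_coeffComp h hb]
    simp [tensorMul]

theorem C_mul_mem {S : Submodule K (Polynomial K)} {p : Polynomial K} (hp : p ∈ S) (c : K) :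
    Polynomial.C c * p ∈ S := by
  rw [← Polynomial.smul_eq_C_mul]
  exact Submodule.smul_mem _ _ hp

theorem tensorMul_mem_expansionComp_left {k m α β : ℕ} {p q : Polynomial K}
    (hp : p ∈ binaryComp K k α) (hq : q ∈ degreeLT K β) (h : α + β ≤ m + 1) :
    tensorMul p q ∈ expansionComp K k m := by
  induction β generalizing q with
  | zero => rw [degreeLT_eq_bot_of_eq_zero rfl hq]; simp [tensorMul]
  | succ n ih =>
    have h1 := ih (natDegree_sub_lead_lt k hq) (by omega)
    have h2 : tensorMul p (Polynomial.C (q.coeff n) * lead K k n) ∈ expansionComp K k m := by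
      rw [tensorMul_C_mul]
      exact tensorMul_lead_mem_expansionComp (Submodule.mem_sup_left
        (C_mul_mem (binaryComp_mono (by omega) hp) _))
    simpa [← tensorMul_add_right] using add_mem h1 h2

theorem tensorMul_mem_expansionComp_right {k m α β : ℕ} {p q : Polynomial K}
    (hp : p ∈ degreeLT K α) (hq : q ∈ binaryComp K k β) (h : α + β ≤ m + 1) :
    tensorMul p q ∈ expansionComp K k m := by
  obtain ⟨n, hn⟩ : ∃ n, q ∈ degreeLT K n := ⟨β, binaryComp_le_degreeLT hq⟩
  induction n generalizing q with
  | zero => rw [degreeLT_eq_bot_of_eq_zero rfl hn]; simp [tensorMul]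
  | succ n ih =>
    by_cases hc : q.coeff n = 0
    · exact ih hq (by simpa [hc] using natDegree_sub_lead_lt k hn)
    have h0 : q ≠ 0 := by rintro rfl; simp at hc
    have hdeg : q.natDegree = n := by
      refine le_antisymm ?_ (Polynomial.le_natDegree_of_ne_zero hc)
      rw [mem_degreeLT, ← Polynomial.natDegree_lt_iff_degree_lt h0] at hn
      omega
    have hlt := orderAt_lt hq h0
    rw [hdeg] at hlt
    have h1 := ih (sub_mem hq (C_mul_mem (binaryComp_mono hlt (lead_mem k n)) (q.coeff n)))
      (natDegree_sub_lead_lt k hn)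
    have h2 : tensorMul p (Polynomial.C (q.coeff n) * lead K k n) ∈ expansionComp K k m := by
      rw [tensorMul_C_mul]
      exact tensorMul_lead_mem_expansionComp (Submodule.mem_sup_right
        (C_mul_mem (Polynomial.degreeLT_mono (by omega) hp) _))
    simpa [← tensorMul_add_right] using add_mem h1 h2

theorem coeff_sum_tensorMul_lead {k M s : ℕ} (b : ℕ → Polynomial K) (h : M ≤ s) :
    (∑ d ∈ Finset.range M, tensorMul (b d) (lead K k d)).coeff s = 0 := by
  rw [Polynomial.finsetSum_coeff]
  refine Finset.sum_eq_zero fun d hd => ?_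
  have : (lead K k d).coeff s = 0 := Polynomial.coeff_eq_zero_of_natDegree_lt
    (by rw [natDegree_lead]; exact (Finset.mem_range.1 hd).trans_le h)
  rw [coeff_tensorMul, this]
  simp

theorem coeff_sum_tensorMul_lead_succ {k s : ℕ} (b : ℕ → Polynomial K) :
    (∑ d ∈ Finset.range (s + 1), tensorMul (b d) (lead K k d)).coeff s = b s := by
  have : (lead K k s).coeff s = 1 := by
    have := (lead_monic (K := K) k s).coeff_natDegree
    rwa [natDegree_lead] at this
  rw [Finset.sum_range_succ, Polynomial.coeff_add, coeff_sum_tensorMul_lead b le_rfl,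
    coeff_tensorMul, this]
  simp

theorem coeff_mem_coeffComp {k m s : ℕ} {w : Polynomial (Polynomial K)}
    (hw : w ∈ expansionComp K k m) (hs : ∀ b, s < b → w.coeff b = 0) :
    w.coeff s ∈ coeffComp K k m s := by
  obtain ⟨b, hb, rfl⟩ := hw
  suffices h : ∀ M, (∀ i, s < i →
      (∑ d ∈ Finset.range M, tensorMul (b d) (lead K k d)).coeff i = 0) →
      (∑ d ∈ Finset.range M, tensorMul (b d) (lead K k d)).coeff s ∈ coeffComp K k m s from
    h m hs
  intro M
  induction M with
  | zero => intro _; simp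
  | succ M ih =>
    intro hM
    rcases lt_trichotomy M s with h | rfl | h
    · rw [coeff_sum_tensorMul_lead b h]; exact zero_mem _
    · rw [coeff_sum_tensorMul_lead_succ]; exact hb M
    · have h0 := hM M h
      rw [coeff_sum_tensorMul_lead_succ] at h0
      have h1 : tensorMul (b M) (lead K k M) = 0 := by rw [h0]; simp [tensorMul]
      simp only [Finset.sum_range_succ, h1, add_zero] at hM ⊢
      exact ih hM

/-- The dehomogenized degree `m - 1` component of the ideal
`(x ^ k, (t - x) ^ k, y ^ k, (t - y) ^ k)`. -/
def idealComp (K : Type) [Field K] (k m : ℕ) : Submodule K (Polynomial (Polynomial K)) where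
  carrier := {w | ∃ A ∈ totalDegreeLT K (m - k), ∃ B ∈ totalDegreeLT K (m - k),
    ∃ A' ∈ totalDegreeLT K (m - k), ∃ B' ∈ totalDegreeLT K (m - k),
    w = Polynomial.C Polynomial.X ^ k * A + (1 - Polynomial.C Polynomial.X) ^ k * B +
      Polynomial.X ^ k * A' + (1 - Polynomial.X) ^ k * B'}
  add_mem' := by
    rintro _ _ ⟨A, hA, B, hB, A', hA', B', hB', rfl⟩ ⟨C, hC, D, hD, C', hC', D', hD', rfl⟩
    exact ⟨_, add_mem hA hC, _, add_mem hB hD, _, add_mem hA' hC', _, add_mem hB' hD', by ring⟩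
  zero_mem' := ⟨0, zero_mem _, 0, zero_mem _, 0, zero_mem _, 0, zero_mem _, by simp⟩
  smul_mem' := by
    rintro c _ ⟨A, hA, B, hB, A', hA', B', hB', rfl⟩
    exact ⟨_, Submodule.smul_mem _ c hA, _, Submodule.smul_mem _ c hB,
      _, Submodule.smul_mem _ c hA', _, Submodule.smul_mem _ c hB', by simp [smul_add]⟩

theorem sum_tensorMul_coeff (A : Polynomial (Polynomial K)) :
    A = ∑ b ∈ Finset.range (A.natDegree + 1), tensorMul (A.coeff b) (Polynomial.X ^ b) := by
  conv_lhs => rw [A.as_sum_range_C_mul_X_pow]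
  simp [tensorMul]

theorem X_pow_mem_degreeLT (n : ℕ) : (Polynomial.X ^ n : Polynomial K) ∈ degreeLT K (n + 1) := by
  rw [mem_degreeLT, Polynomial.degree_X_pow]; exact_mod_cast Nat.lt_succ_self n

theorem mul_mem_expansionComp {k m : ℕ} {A f : Polynomial (Polynomial K)}
    (hA : A ∈ totalDegreeLT K (m - k))
    (h : ∀ a ∈ degreeLT K (m - k), ∀ b : ℕ, a ∈ degreeLT K (m - k - b) →
      f * tensorMul a (Polynomial.X ^ b) ∈ expansionComp K k m) :
    f * A ∈ expansionComp K k m := by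
  rw [sum_tensorMul_coeff A, Finset.mul_sum]
  exact sum_mem fun b _ => h _ (Polynomial.degreeLT_mono (by omega) (hA b)) b (hA b)

theorem idealComp_le_expansionComp (k m : ℕ) : idealComp K k m ≤ expansionComp K k m := by
  rintro _ ⟨A, hA, B, hB, A', hA', B', hB', rfl⟩
  have hz {a : Polynomial K} {b : ℕ} (h : m ≤ k + b) (ha : a ∈ degreeLT K (m - k - b)) :
      a = 0 := degreeLT_eq_bot_of_eq_zero (by omega) ha
  refine add_mem (add_mem (add_mem ?_ ?_) ?_) ?_
  · refine mul_mem_expansionComp hA fun a _ b ha => ?_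
    rcases Nat.lt_or_ge (k + b) m with h | h
    · have : Polynomial.C Polynomial.X ^ k * tensorMul a (Polynomial.X ^ b) =
          tensorMul (Polynomial.X ^ k * a) (Polynomial.X ^ b) := by
        simp only [tensorMul, Polynomial.C_mul, Polynomial.C_pow, mul_assoc]
      rw [this]
      refine tensorMul_mem_expansionComp_left (α := m - b) (mem_binaryComp.2
        ⟨a, by rwa [Nat.sub_right_comm], 0, zero_mem _, by simp⟩) (X_pow_mem_degreeLT b) (by omega)
    · rw [hz h ha]; simp [tensorMul]
  · refine mul_mem_expansionComp hB fun a _ b ha => ?_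
    rcases Nat.lt_or_ge (k + b) m with h | h
    · have : (1 - Polynomial.C Polynomial.X) ^ k * tensorMul a (Polynomial.X ^ b) =
          tensorMul ((1 - Polynomial.X) ^ k * a) (Polynomial.X ^ b) := by
        simp only [tensorMul, Polynomial.C_mul, Polynomial.C_pow, mul_assoc, Polynomial.C_sub,
          Polynomial.C_1]
      rw [this]
      refine tensorMul_mem_expansionComp_left (α := m - b) (mem_binaryComp.2
        ⟨0, zero_mem _, a, by rwa [Nat.sub_right_comm], by simp⟩) (X_pow_mem_degreeLT b) (by omega)
    · rw [hz h ha]; simp [tensorMul]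
  · refine mul_mem_expansionComp hA' fun a _ b ha => ?_
    rcases Nat.lt_or_ge (k + b) m with h | h
    · have : Polynomial.X ^ k * tensorMul a (Polynomial.X ^ b) =
          tensorMul a (Polynomial.X ^ k * Polynomial.X ^ b) := by
        simp only [tensorMul, Polynomial.map_mul, Polynomial.map_pow, Polynomial.map_X]
        ring
      rw [this]
      refine tensorMul_mem_expansionComp_right ha (β := k + b + 1) (mem_binaryComp.2
        ⟨Polynomial.X ^ b, ?_, 0, zero_mem _, by simp⟩) (by omega)
      rw [show k + b + 1 - k = b + 1 by omega]
      exact X_pow_mem_degreeLT b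
    · rw [hz h ha]; simp [tensorMul]
  · refine mul_mem_expansionComp hB' fun a _ b ha => ?_
    rcases Nat.lt_or_ge (k + b) m with h | h
    · have : (1 - Polynomial.X) ^ k * tensorMul a (Polynomial.X ^ b) =
          tensorMul a ((1 - Polynomial.X) ^ k * Polynomial.X ^ b) := by
        simp only [tensorMul, Polynomial.map_mul, Polynomial.map_pow, Polynomial.map_X,
          Polynomial.map_sub, Polynomial.map_one]
        ring
      rw [this]
      refine tensorMul_mem_expansionComp_right ha (β := k + b + 1) (mem_binaryComp.2
        ⟨0, zero_mem _, Polynomial.X ^ b, ?_, by simp⟩) (by omega)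
      rw [show k + b + 1 - k = b + 1 by omega]
      exact X_pow_mem_degreeLT b
    · rw [hz h ha]; simp [tensorMul]

theorem tensorMul_lead_mem_idealComp {k m s : ℕ} {b : Polynomial K}
    (hb : b ∈ coeffComp K k m s) : tensorMul b (lead K k s) ∈ idealComp K k m := by
  obtain ⟨w, hw, z, hz, rfl⟩ := Submodule.mem_sup.1 hb
  rw [tensorMul_add_left]
  refine add_mem ?_ ?_
  · rcases Nat.lt_or_ge (k + s) m with h | h
    swap
    · rw [eq_zero_of_mem_binaryComp (by omega) hw]; simp [tensorMul]
    obtain ⟨a, ha, a', ha', rfl⟩ := mem_binaryComp.1 hw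
    have he : lead K k s ∈ degreeLT K (s + 1) := by
      rw [mem_degreeLT, ← Polynomial.natDegree_lt_iff_degree_lt (lead_monic k s).ne_zero,
        natDegree_lead]
      omega
    refine ⟨tensorMul a (lead K k s), tensorMul_mem ha he (by omega), tensorMul a' (lead K k s),
      tensorMul_mem ha' he (by omega), 0, zero_mem _, 0, zero_mem _, ?_⟩
    simp only [tensorMul, Polynomial.C_add, Polynomial.C_mul, Polynomial.C_pow, Polynomial.C_sub,
      Polynomial.C_1]
    ring
  · rcases Nat.lt_or_ge (orderAt K k s) m with h | h
    swap
    · rw [degreeLT_eq_bot_of_eq_zero (by omega) hz]; simp [tensorMul]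
    have he := lead_mem (K := K) k s
    by_cases hN : orderAt K k s + 1 ≤ k
    · exact absurd (eq_zero_of_mem_binaryComp hN he) (lead_monic k s).ne_zero
    obtain ⟨a, ha, a', ha', h'⟩ := mem_binaryComp.1 he
    refine ⟨0, zero_mem _, 0, zero_mem _, tensorMul z a, tensorMul_mem hz ha (by omega),
      tensorMul z a', tensorMul_mem hz ha' (by omega), ?_⟩
    rw [← h']
    simp only [tensorMul, Polynomial.map_add, Polynomial.map_mul, Polynomial.map_pow,
      Polynomial.map_X, Polynomial.map_sub, Polynomial.map_one]
    ring

end Bivariate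

section Dehomogenization

open Polynomial (degreeLT mem_degreeLT)

variable {K : Type} [Field K]

/-- Dehomogenization with respect to the last variable. -/
def dehom (K : Type) [Field K] : R3 K →ₐ[K] Polynomial (Polynomial K) :=
  MvPolynomial.aeval ![Polynomial.C Polynomial.X, Polynomial.X, 1]

theorem dehom_X_zero : dehom K (X 0) = Polynomial.C Polynomial.X := by simp [dehom]

theorem dehom_X_one : dehom K (X 1) = Polynomial.X := by simp [dehom]

theorem dehom_X_two : dehom K (X 2) = 1 := by simp [dehom]

theorem dehom_monomial (m : Fin 3 →₀ ℕ) (c : K) :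
    dehom K (monomial m c) = Polynomial.monomial (m 1) (Polynomial.monomial (m 0) c) := by
  rw [dehom, MvPolynomial.aeval_monomial, Finsupp.prod_fintype _ _ (by simp), Fin.prod_univ_three,
    ← Polynomial.C_mul_X_pow_eq_monomial, ← Polynomial.C_mul_X_pow_eq_monomial]
  simp [Polynomial.algebraMap_apply, mul_assoc]

theorem dehom_eq_sum (u : R3 K) : dehom K u = ∑ m ∈ u.support,
    Polynomial.monomial (m 1) (Polynomial.monomial (m 0) (u.coeff m)) := by
  conv_lhs => rw [u.as_sum, map_sum]
  exact Finset.sum_congr rfl fun m _ => dehom_monomial m _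

theorem degree_fin_three (m : Fin 3 →₀ ℕ) : m.degree = m 0 + m 1 + m 2 := by
  rw [Finsupp.degree_eq_sum, Fin.sum_univ_three]

theorem coeff_dehom {u : R3 K} {n : ℕ} (hu : u.IsHomogeneous n) (m : Fin 3 →₀ ℕ)
    (hm : m.degree = n) : ((dehom K u).coeff (m 1)).coeff (m 0) = u.coeff m := by
  rw [dehom_eq_sum, Polynomial.finsetSum_coeff, Polynomial.finsetSum_coeff,
    Finset.sum_eq_single m]
  · simp
  · intro m' hm' hne
    have hd : m'.degree = n := by
      by_contra h
      exact (mem_support_iff.1 hm') (hu.coeff_eq_zero h)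
    rw [Polynomial.coeff_monomial]
    split_ifs with h1
    · rw [Polynomial.coeff_monomial, if_neg]
      intro h0
      refine hne (Finsupp.ext fun i => ?_)
      rw [degree_fin_three] at hd hm
      fin_cases i
      · exact h0
      · exact h1
      · change m' 2 = m 2; omega
    · simp
  · intro h
    simp [notMem_support_iff.1 h]

theorem dehom_injOn {u : R3 K} {n : ℕ} (hu : u.IsHomogeneous n) (h : dehom K u = 0) : u = 0 := by
  ext m
  by_cases hm : m.degree = n
  · rw [← coeff_dehom hu m hm, h]; simp
  · rw [hu.coeff_eq_zero hm]; simp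

theorem dehom_mem {u : R3 K} {n : ℕ} (hu : u.IsHomogeneous n) :
    dehom K u ∈ totalDegreeLT K (n + 1) := by
  rw [dehom_eq_sum]
  refine sum_mem fun m hm b => ?_
  have hd : m.degree = n := by
    by_contra h
    exact (mem_support_iff.1 hm) (hu.coeff_eq_zero h)
  rw [degree_fin_three] at hd
  rw [Polynomial.coeff_monomial]
  split_ifs with h
  · rw [mem_degreeLT]
    refine (Polynomial.degree_monomial_le _ _).trans_lt ?_
    exact_mod_cast (by omega)
  · exact zero_mem _

theorem exists_dehom_eq {w : Polynomial (Polynomial K)} {n : ℕ}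
    (hw : w ∈ totalDegreeLT K (n + 1)) : ∃ u : R3 K, u.IsHomogeneous n ∧ dehom K u = w := by
  suffices h : w ∈ (homogeneousSubmodule (Fin 3) K n).map (dehom K).toLinearMap by
    obtain ⟨u, hu, h⟩ := h
    exact ⟨u, hu, h⟩
  rw [w.as_sum_range]
  refine sum_mem fun b _ => ?_
  rw [(w.coeff b).as_sum_range, map_sum]
  refine sum_mem fun a _ => ?_
  by_cases h : ((w.coeff b).coeff a) = 0
  · simp [h]
  have hab : a < n + 1 - b := by
    by_contra hcon
    have := hw b
    rw [mem_degreeLT, Polynomial.degree_lt_iff_coeff_zero] at this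
    exact h (this a (by exact_mod_cast not_lt.1 hcon))
  refine ⟨monomial (Finsupp.equivFunOnFinite.symm ![a, b, n - a - b]) ((w.coeff b).coeff a),
    ?_, ?_⟩
  · refine isHomogeneous_monomial _ ?_
    rw [degree_fin_three]
    simp
    omega
  · simp [dehom_monomial]

theorem exists_eq_of_isHomogeneous_mul {G A : R3 K} {k i : ℕ} (hG : G.IsHomogeneous k) :
    ∃ B : R3 K, homogeneousComponent i (G * A) = G * B ∧
      ((k ≤ i ∧ B.IsHomogeneous (i - k)) ∨ B = 0) := by
  have hA : G * A = ∑ d ∈ Finset.range (A.totalDegree + 1), G * homogeneousComponent d A := by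
    rw [← Finset.mul_sum, sum_homogeneousComponent]
  have hc (d : ℕ) : homogeneousComponent i (G * homogeneousComponent d A) =
      if i = k + d then G * homogeneousComponent d A else 0 :=
    homogeneousComponent_of_mem (hG.mul (homogeneousComponent_isHomogeneous d A))
  rcases Nat.lt_or_ge i k with h | h
  · refine ⟨0, ?_, Or.inr rfl⟩
    rw [hA, map_sum, mul_zero]
    refine Finset.sum_eq_zero fun d _ => ?_
    rw [hc, if_neg (by omega)]
  · refine ⟨homogeneousComponent (i - k) A, ?_,
      Or.inl ⟨h, homogeneousComponent_isHomogeneous _ _⟩⟩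
    rw [hA, map_sum, Finset.sum_eq_single (i - k)]
    · rw [hc, if_pos (by omega)]
    · intro d _ hd
      rw [hc, if_neg (by omega)]
    · intro hd
      rw [hc, if_pos (by omega)]
      rw [homogeneousComponent_eq_zero _ _ (by
        rw [Finset.mem_range] at hd; omega), mul_zero]

theorem mem_span_four {R : Type*} [CommRing R] {g₀ g₁ g₂ g₃ u : R} :
    u ∈ Ideal.span {g₀, g₁, g₂, g₃} ↔
      ∃ a b c d, u = g₀ * a + g₁ * b + g₂ * c + g₃ * d := by
  simp only [Ideal.mem_span_insert, Ideal.mem_span_singleton']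
  constructor
  · rintro ⟨a, _, ⟨b, _, ⟨c, _, ⟨d, rfl⟩, rfl⟩, rfl⟩, rfl⟩
    exact ⟨a, b, c, d, by ring⟩
  · rintro ⟨a, b, c, d, rfl⟩
    exact ⟨a, _, ⟨b, _, ⟨c, _, ⟨d, rfl⟩, rfl⟩, rfl⟩, by ring⟩

/-- The ideal `(x ^ k, (t - x) ^ k, y ^ k, (t - y) ^ k)`. -/
def stdIdeal (K : Type) [Field K] (k : ℕ) : Ideal (R3 K) :=
  Ideal.span {X 0 ^ k, (X 2 - X 0) ^ k, X 1 ^ k, (X 2 - X 1) ^ k}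

theorem dehom_mem_idealComp {k i : ℕ} {u : R3 K} (hu : u.IsHomogeneous i)
    (h : u ∈ stdIdeal K k) : dehom K u ∈ idealComp K k (i + 1) := by
  obtain ⟨a, b, c, d, rfl⟩ := mem_span_four.1 h
  have h0 : ((X 0 : R3 K) ^ k).IsHomogeneous k := isHomogeneous_X_pow 0 k
  have h1 : ((X 2 - X 0 : R3 K) ^ k).IsHomogeneous k := by
    simpa using ((isHomogeneous_X K 2).sub (isHomogeneous_X K 0)).pow k
  have h2 : ((X 1 : R3 K) ^ k).IsHomogeneous k := isHomogeneous_X_pow 1 k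
  have h3 : ((X 2 - X 1 : R3 K) ^ k).IsHomogeneous k := by
    simpa using ((isHomogeneous_X K 2).sub (isHomogeneous_X K 1)).pow k
  have key {G : R3 K} (hG : G.IsHomogeneous k) (A : R3 K) :
      ∃ B : R3 K, homogeneousComponent i (G * A) = G * B ∧
        dehom K B ∈ totalDegreeLT K (i + 1 - k) := by
    obtain ⟨B, hB, h | rfl⟩ := exists_eq_of_isHomogeneous_mul (A := A) (i := i) hG
    · refine ⟨B, hB, ?_⟩
      rw [Nat.sub_add_comm h.1]
      exact dehom_mem h.2
    · exact ⟨0, hB, by rw [map_zero]; exact zero_mem _⟩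
  obtain ⟨A, hA, hA'⟩ := key h0 a
  obtain ⟨B, hB, hB'⟩ := key h1 b
  obtain ⟨C, hC, hC'⟩ := key h2 c
  obtain ⟨D, hD, hD'⟩ := key h3 d
  refine ⟨_, hA', _, hB', _, hC', _, hD', ?_⟩
  rw [← homogeneousComponent_eq_self hu]
  simp only [map_add, hA, hB, hC, hD, map_mul, map_pow, map_sub, dehom_X_zero, dehom_X_one,
    dehom_X_two]

theorem exists_dehom_eq_of_mem {k i : ℕ} {w : Polynomial (Polynomial K)}
    (h : w ∈ idealComp K k (i + 1)) :
    ∃ u ∈ stdIdeal K k, u.IsHomogeneous i ∧ dehom K u = w := by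
  obtain ⟨A, hA, B, hB, C, hC, D, hD, rfl⟩ := h
  rcases Nat.lt_or_ge i k with hik | hik
  · have hz {A : Polynomial (Polynomial K)} (hA : A ∈ totalDegreeLT K (i + 1 - k)) : A = 0 := by
      ext1 b
      exact degreeLT_eq_bot_of_eq_zero (by omega) (hA b)
    refine ⟨0, zero_mem _, isHomogeneous_zero _ _ _, ?_⟩
    rw [hz hA, hz hB, hz hC, hz hD]
    simp
  rw [Nat.sub_add_comm hik] at hA hB hC hD
  obtain ⟨a, ha, rfl⟩ := exists_dehom_eq hA
  obtain ⟨b, hb, rfl⟩ := exists_dehom_eq hB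
  obtain ⟨c, hc, rfl⟩ := exists_dehom_eq hC
  obtain ⟨d, hd, rfl⟩ := exists_dehom_eq hD
  refine ⟨X 0 ^ k * a + (X 2 - X 0) ^ k * b + X 1 ^ k * c + (X 2 - X 1) ^ k * d,
    mem_span_four.2 ⟨a, b, c, d, rfl⟩, ?_, ?_⟩
  · have h1 : ((X 2 - X 0 : R3 K) ^ k).IsHomogeneous k := by
      simpa using ((isHomogeneous_X K 2).sub (isHomogeneous_X K 0)).pow k
    have h3 : ((X 2 - X 1 : R3 K) ^ k).IsHomogeneous k := by
      simpa using ((isHomogeneous_X K 2).sub (isHomogeneous_X K 1)).pow k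
    rw [← Nat.add_sub_cancel' hik]
    exact ((((isHomogeneous_X_pow 0 k).mul ha).add (h1.mul hb)).add
      ((isHomogeneous_X_pow 1 k).mul hc)).add (h3.mul hd)
  · simp only [map_add, map_mul, map_pow, map_sub, dehom_X_zero, dehom_X_one, dehom_X_two]

/-- The quotient by `stdIdeal K k` has no socle in degrees below `2 * k - 2`. -/
theorem stdIdeal_socle {k i : ℕ} (hi : i + 3 ≤ 2 * k) {u : R3 K} (hu : u.IsHomogeneous i)
    (h : ∀ t, X t * u ∈ stdIdeal K k) : u ∈ stdIdeal K k := by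
  suffices H : ∀ s, ∀ u : R3 K, u.IsHomogeneous i → (∀ t, X t * u ∈ stdIdeal K k) →
      (∀ b, s ≤ b → (dehom K u).coeff b = 0) → u ∈ stdIdeal K k from
    H ((dehom K u).natDegree + 1) u hu h fun b hb =>
      Polynomial.coeff_eq_zero_of_natDegree_lt hb
  intro s
  induction s with
  | zero =>
    intro u hu _ hs
    rw [dehom_injOn hu (by ext1 b; exact hs b (Nat.zero_le b))]
    exact zero_mem _
  | succ s ih =>
    intro u hu h hs
    have hE (t : Fin 3) : dehom K (X t * u) ∈ expansionComp K k (i + 1 + 1) :=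
      idealComp_le_expansionComp _ _ (dehom_mem_idealComp
        (by simpa [add_comm] using (isHomogeneous_X K t).mul hu) (h t))
    have h0 := hE 0
    have h1 := hE 1
    have h2 := hE 2
    rw [map_mul, dehom_X_zero] at h0
    rw [map_mul, dehom_X_one] at h1
    rw [map_mul, dehom_X_two, one_mul] at h2
    have c2 := coeff_mem_coeffComp (s := s) h2 hs
    have c0 := coeff_mem_coeffComp (s := s) h0
      (fun b hb => by rw [Polynomial.coeff_C_mul, hs b hb, mul_zero])
    rw [Polynomial.coeff_C_mul] at c0
    have c1 := coeff_mem_coeffComp (s := s + 1) h1 (fun b hb => by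
      obtain ⟨b, rfl⟩ : ∃ b', b = b' + 1 := ⟨b - 1, by omega⟩
      rw [Polynomial.coeff_X_mul, hs b (by omega)])
    rw [Polynomial.coeff_X_mul, coeffComp, Nat.add_sub_add_right] at c1
    have hv := mem_sup_of_socle (by omega) c2 c0 c1
    obtain ⟨u', hu', hom', he⟩ := exists_dehom_eq_of_mem
      (tensorMul_lead_mem_idealComp (s := s) hv)
    have := ih (u - u') (hu.sub hom')
      (fun t => by rw [mul_sub]; exact sub_mem (h t) (Ideal.mul_mem_left _ _ hu')) ?_
    · simpa using add_mem this hu'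
    · intro b hb
      rw [map_sub, Polynomial.coeff_sub, he, coeff_tensorMul]
      rcases hb.eq_or_lt with rfl | hb
      · have : (lead K k s).coeff s = 1 := by
          have := (lead_monic (K := K) k s).coeff_natDegree
          rwa [natDegree_lead] at this
        simp [this]
      · have : (lead K k s).coeff b = 0 :=
          Polynomial.coeff_eq_zero_of_natDegree_lt (by rw [natDegree_lead]; exact hb)
        simp [hs b hb, this]

end Dehomogenization

section LinearSubstitution

variable {K : Type} [Field K]

theorem linForm_add (v w : Fin 3 → K) : linForm K (v + w) = linForm K v + linForm K w := by
  simp [linForm, add_mul, Finset.sum_add_distrib]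

theorem linForm_smul (a : K) (v : Fin 3 → K) : linForm K (a • v) = C a * linForm K v := by
  simp [linForm, Finset.mul_sum, mul_assoc]

theorem linForm_single (t : Fin 3) : linForm K (Pi.single t 1) = X t := by
  rw [linForm, Finset.sum_eq_single t] <;> simp +contextual

theorem linForm_isHomogeneous (v : Fin 3 → K) : (linForm K v).IsHomogeneous 1 :=
  IsHomogeneous.sum _ _ _ fun t _ => isHomogeneous_C_mul_X (v t) t

/-- The substitution sending the variables to the linear forms given by the rows of `A`. -/
def linSubst (A : Matrix (Fin 3) (Fin 3) K) : R3 K →ₐ[K] R3 K :=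
  MvPolynomial.aeval fun t => linForm K (A t)

theorem linSubst_X (A : Matrix (Fin 3) (Fin 3) K) (t : Fin 3) :
    linSubst A (X t) = linForm K (A t) := by simp [linSubst]

theorem linSubst_C (A : Matrix (Fin 3) (Fin 3) K) (a : K) : linSubst A (C a) = C a := by
  simp [linSubst]

theorem linSubst_linForm (A : Matrix (Fin 3) (Fin 3) K) (v : Fin 3 → K) :
    linSubst A (linForm K v) = linForm K (Matrix.vecMul v A) := by
  rw [Matrix.vecMul_eq_sum]
  simp only [Fin.sum_univ_three, linForm_add, linForm_smul]
  rw [linForm, Fin.sum_univ_three]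
  simp only [map_add, map_mul, linSubst_X, linSubst_C]

theorem linSubst_linSubst (A B : Matrix (Fin 3) (Fin 3) K) (u : R3 K) :
    linSubst A (linSubst B u) = linSubst (B * A) u := by
  have : (linSubst A).comp (linSubst B) = linSubst (B * A) := by
    refine MvPolynomial.algHom_ext fun t => ?_
    rw [AlgHom.comp_apply, linSubst_X, linSubst_linForm, linSubst_X, Matrix.mul_apply_eq_vecMul]
  rw [← this, AlgHom.comp_apply]

theorem linSubst_one (u : R3 K) : linSubst 1 u = u := by
  have : linSubst (1 : Matrix (Fin 3) (Fin 3) K) = AlgHom.id K (R3 K) := by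
    refine MvPolynomial.algHom_ext fun t => ?_
    rw [linSubst_X, AlgHom.id_apply, ← linForm_single]
    congr 1
    ext i
    rw [Matrix.one_apply, Pi.single_apply]
    simp [eq_comm]
  rw [this, AlgHom.id_apply]

theorem linSubst_isHomogeneous (A : Matrix (Fin 3) (Fin 3) K) {u : R3 K} {n : ℕ}
    (hu : u.IsHomogeneous n) : (linSubst A u).IsHomogeneous n := by
  have := hu.aeval (fun t => linForm K (A t)) fun t => linForm_isHomogeneous (A t)
  rwa [one_mul] at this

theorem linSubst_linSubst_inv {A : Matrix (Fin 3) (Fin 3) K} (hA : IsUnit A.det) (u : R3 K) :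
    linSubst A (linSubst A⁻¹ u) = u := by
  rw [linSubst_linSubst, Matrix.nonsing_inv_mul A hA, linSubst_one]

theorem linSubst_inv_linSubst {A : Matrix (Fin 3) (Fin 3) K} (hA : IsUnit A.det) (u : R3 K) :
    linSubst A⁻¹ (linSubst A u) = u := by
  rw [linSubst_linSubst, Matrix.mul_nonsing_inv A hA, linSubst_one]

/-- The forms of degree `n` are spanned by the monomials in three independent linear forms. -/
theorem homogeneousSubmodule_le {n : ℕ} {A : Matrix (Fin 3) (Fin 3) K} (hA : IsUnit A.det)
    {S : Submodule K (R3 K)} (h : ∀ a b c, a + b + c = n →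
      linForm K (A 0) ^ a * linForm K (A 1) ^ b * linForm K (A 2) ^ c ∈ S) :
    homogeneousSubmodule (Fin 3) K n ≤ S := by
  intro u hu
  have hu' := linSubst_isHomogeneous A⁻¹ hu
  rw [← linSubst_linSubst_inv hA u, (linSubst A⁻¹ u).as_sum, map_sum]
  refine sum_mem fun m hm => ?_
  have hd : m.degree = n := by
    by_contra h
    exact (mem_support_iff.1 hm) (hu'.coeff_eq_zero h)
  rw [degree_fin_three] at hd
  rw [MvPolynomial.monomial_eq, ← smul_eq_C_mul, map_smul,
    Finsupp.prod_fintype _ _ (by simp), Fin.prod_univ_three]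
  refine Submodule.smul_mem _ _ ?_
  simp only [map_mul, map_pow, linSubst_X]
  exact h _ _ _ hd

end LinearSubstitution

section FourPowers

variable {K : Type} [Field K]

/-- The ideal generated by the `k`-th powers of the four linear forms with coefficient vectors
`c 0, …, c 3`. -/
def powerIdeal (c : Fin 5 → Fin 3 → K) (k : ℕ) : Ideal (R3 K) :=
  Ideal.span
    {linForm K (c 0) ^ k, linForm K (c 1) ^ k, linForm K (c 2) ^ k, linForm K (c 3) ^ k}

/-- The first three forms are independent, and the coordinates of the other two with respect to
them are nonzero. -/
structure InGeneralPosition (c : Fin 5 → Fin 3 → K) : Prop where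
  isUnit_det : IsUnit (Matrix.of ![c 0, c 1, c 2]).det
  exists_fourth : ∃ p q r : K, p ≠ 0 ∧ q ≠ 0 ∧ r ≠ 0 ∧ c 3 = p • c 0 + q • c 1 + r • c 2
  exists_fifth : ∃ p q r : K, p ≠ 0 ∧ c 4 = p • c 0 + q • c 1 + r • c 2

theorem powerIdeal_socle {c : Fin 5 → Fin 3 → K} (hc : InGeneralPosition c) {k i : ℕ}
    (hi : i + 3 ≤ 2 * k) {u : R3 K} (hu : u.IsHomogeneous i)
    (h : ∀ t, X t * u ∈ powerIdeal c k) : u ∈ powerIdeal c k := by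
  obtain ⟨p, q, r, hp, hq, hr, h3⟩ := hc.exists_fourth
  set A : Matrix (Fin 3) (Fin 3) K :=
    !![p, 0, 0; 0, 0, -r; p, q, 0] * Matrix.of ![c 0, c 1, c 2] with hA
  have hdet : IsUnit A.det := by
    rw [hA, Matrix.det_mul]
    refine IsUnit.mul ?_ hc.isUnit_det
    rw [Matrix.det_fin_three]
    simp [hp, hq, hr]
  have e0 : linSubst A (X 0) = C p * linForm K (c 0) := by
    rw [linSubst_X, ← linForm_smul, hA, Matrix.mul_apply_eq_vecMul, Matrix.vecMul_eq_sum]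
    simp [Fin.sum_univ_three]
    rfl
  have e1 : linSubst A (X 1) = C (-r) * linForm K (c 2) := by
    rw [linSubst_X, ← linForm_smul, hA, Matrix.mul_apply_eq_vecMul, Matrix.vecMul_eq_sum]
    simp [Fin.sum_univ_three]
    rfl
  have e2 : linSubst A (X 2) = C p * linForm K (c 0) + C q * linForm K (c 1) := by
    rw [linSubst_X, ← linForm_smul, ← linForm_smul, ← linForm_add, hA,
      Matrix.mul_apply_eq_vecMul, Matrix.vecMul_eq_sum]
    simp [Fin.sum_univ_three]
    rfl
  have e20 : linSubst A (X 2 - X 0) = C q * linForm K (c 1) := by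
    rw [map_sub, e0, e2]; ring
  have e21 : linSubst A (X 2 - X 1) = linForm K (c 3) := by
    rw [map_sub, e1, e2, h3, linForm_add, linForm_add, linForm_smul, linForm_smul, linForm_smul,
      C_neg]
    ring
  have hto : ∀ w ∈ stdIdeal K k, linSubst A w ∈ powerIdeal c k := by
    intro w hw
    obtain ⟨a, b, d, e, rfl⟩ := mem_span_four.1 hw
    refine mem_span_four.2 ⟨C p ^ k * linSubst A a, C q ^ k * linSubst A b,
      C (-r) ^ k * linSubst A d, linSubst A e, ?_⟩
    simp only [map_add, map_mul, map_pow, e0, e1, e20, e21]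
    ring
  have inv {a : K} (ha : a ≠ 0) {x : R3 K} {ℓ : R3 K} (h : linSubst A x = C a * ℓ) :
      linSubst A⁻¹ ℓ = C a⁻¹ * x := by
    rw [← linSubst_inv_linSubst hdet x, h, map_mul, linSubst_C, ← mul_assoc, ← C_mul,
      inv_mul_cancel₀ ha, C_1, one_mul]
  have i0 := inv hp e0
  have i1 := inv (neg_ne_zero.2 hr) e1
  have i2 := inv hq e20
  have i3 : linSubst A⁻¹ (linForm K (c 3)) = X 2 - X 1 := by
    rw [← e21, linSubst_inv_linSubst hdet]
  have hfrom : ∀ w ∈ powerIdeal c k, linSubst A⁻¹ w ∈ stdIdeal K k := by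
    intro w hw
    obtain ⟨a, b, d, e, rfl⟩ := mem_span_four.1 hw
    refine mem_span_four.2 ⟨C p⁻¹ ^ k * linSubst A⁻¹ a, C q⁻¹ ^ k * linSubst A⁻¹ b,
      C (-r)⁻¹ ^ k * linSubst A⁻¹ d, linSubst A⁻¹ e, ?_⟩
    simp only [map_add, map_mul, map_pow, i0, i1, i2, i3, mul_pow]
    ring
  rw [← linSubst_linSubst_inv hdet u]
  refine hto _ (stdIdeal_socle hi (linSubst_isHomogeneous _ hu) fun t => ?_)
  rw [← linSubst_inv_linSubst hdet (X t), ← map_mul]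
  refine hfrom _ ?_
  rw [linSubst_X, linForm, Finset.sum_mul]
  refine sum_mem fun s _ => ?_
  rw [mul_assoc]
  exact Ideal.mul_mem_left _ _ (h s)

end FourPowers

section Quotient

variable {K : Type} [Field K] {I : Ideal (R3 K)}

theorem mem_quotComp {d : ℕ} {x : R3 K ⧸ I} :
    x ∈ quotComp K I d ↔ ∃ u : R3 K, u.IsHomogeneous d ∧ Ideal.Quotient.mk I u = x := Iff.rfl

theorem mk_mem_quotComp {d : ℕ} {u : R3 K} (hu : u.IsHomogeneous d) :
    Ideal.Quotient.mk I u ∈ quotComp K I d := ⟨u, hu, rfl⟩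

theorem mk_mul_mem_quotComp {d e n : ℕ} {u : R3 K} {x : R3 K ⧸ I} (hu : u.IsHomogeneous d)
    (hx : x ∈ quotComp K I e) (h : d + e = n) : Ideal.Quotient.mk I u * x ∈ quotComp K I n := by
  obtain ⟨v, hv, rfl⟩ := mem_quotComp.1 hx
  rw [← map_mul, ← h]
  exact mk_mem_quotComp (hu.mul hv)

instance finite_quotComp (d : ℕ) : Module.Finite K (quotComp K I d) := by
  rw [Module.Finite.iff_fg]
  exact (homogeneousSubmodule_fg (σ := Fin 3) (R := K) d).map _

theorem hilb_eq_zero_iff {d : ℕ} : hilb K I d = 0 ↔ quotComp K I d = ⊥ :=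
  Submodule.finrank_eq_zero

/-- `[R/I]_n` is spanned by the monomials in three independent linear forms. -/
theorem quotComp_le {n : ℕ} {A : Matrix (Fin 3) (Fin 3) K} (hA : IsUnit A.det)
    {S : Submodule K (R3 K ⧸ I)} (h : ∀ a b c, a + b + c = n → Ideal.Quotient.mk I
      (linForm K (A 0) ^ a * linForm K (A 1) ^ b * linForm K (A 2) ^ c) ∈ S) :
    quotComp K I n ≤ S :=
  Submodule.map_le_iff_le_comap.2 (homogeneousSubmodule_le hA h)

theorem monomial_isHomogeneous (A : Matrix (Fin 3) (Fin 3) K) (a b c : ℕ) :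
    (linForm K (A 0) ^ a * linForm K (A 1) ^ b * linForm K (A 2) ^ c).IsHomogeneous
      (a + b + c) := by
  simpa using (((linForm_isHomogeneous (A 0)).pow a).mul ((linForm_isHomogeneous (A 1)).pow b)).mul
    ((linForm_isHomogeneous (A 2)).pow c)

theorem quotComp_succ_le {n : ℕ} {S : Submodule K (R3 K ⧸ I)}
    (h : ∀ t : Fin 3, ∀ x ∈ quotComp K I n, Ideal.Quotient.mk I (X t) * x ∈ S) :
    quotComp K I (n + 1) ≤ S := by
  refine quotComp_le (A := 1) (by simp) fun a b c habc => ?_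
  have hX (t : Fin 3) : linForm K ((1 : Matrix (Fin 3) (Fin 3) K) t) = X t := by
    rw [← linSubst_X, linSubst_one]
  have hm := monomial_isHomogeneous (K := K) 1
  rcases Nat.eq_zero_or_pos a with rfl | ha
  · rcases Nat.eq_zero_or_pos b with rfl | hb
    · obtain ⟨c, rfl⟩ : ∃ c', c = c' + 1 := ⟨c - 1, by omega⟩
      have := h 2 _ (mk_mem_quotComp (I := I) (d := n)
        (by
          have := hm 0 0 c
          rwa [show 0 + 0 + c = n by omega] at this))
      rw [← hX, ← map_mul] at this
      convert this using 2
      ring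
    · obtain ⟨b, rfl⟩ : ∃ b', b = b' + 1 := ⟨b - 1, by omega⟩
      have := h 1 _ (mk_mem_quotComp (I := I) (d := n)
        (by
          have := hm 0 b c
          rwa [show 0 + b + c = n by omega] at this))
      rw [← hX, ← map_mul] at this
      convert this using 2
      ring
  · obtain ⟨a, rfl⟩ : ∃ a', a = a' + 1 := ⟨a - 1, by omega⟩
    have := h 0 _ (mk_mem_quotComp (I := I) (d := n)
      (by simpa [show a + b + c = n by omega] using hm a b c))
    rw [← hX, ← map_mul] at this
    convert this using 2
    ring

/-- Surjectivity of `×G` onto degree `n` propagates upwards. -/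
theorem surjective_mul_succ {m n : ℕ} {g : R3 K ⧸ I}
    (h : ∀ v ∈ quotComp K I n, ∃ u ∈ quotComp K I m, g * u = v) :
    ∀ v ∈ quotComp K I (n + 1), ∃ u ∈ quotComp K I (m + 1), g * u = v := by
  have : quotComp K I (n + 1) ≤ (quotComp K I (m + 1)).map (LinearMap.mulLeft K g) := by
    refine quotComp_succ_le fun t x hx => ?_
    obtain ⟨u, hu, rfl⟩ := h x hx
    exact ⟨_, mk_mul_mem_quotComp (isHomogeneous_X K t) hu (add_comm _ _), by
      rw [LinearMap.mulLeft_apply]; ring⟩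
  exact this

/-- Absence of socle propagates injectivity of `×G` downwards. -/
theorem injective_mul_of_socle {n : ℕ} {g : R3 K ⧸ I}
    (hs : ∀ u : R3 K, u.IsHomogeneous n → (∀ t, X t * u ∈ I) → u ∈ I)
    (h : ∀ u ∈ quotComp K I (n + 1), g * u = 0 → u = 0) :
    ∀ u ∈ quotComp K I n, g * u = 0 → u = 0 := by
  rintro _ hx hu
  obtain ⟨u, hu', rfl⟩ := mem_quotComp.1 hx
  rw [Ideal.Quotient.eq_zero_iff_mem]
  refine hs u hu' fun t => ?_
  rw [← Ideal.Quotient.eq_zero_iff_mem, map_mul]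
  refine h _ (mk_mul_mem_quotComp (isHomogeneous_X K t) hx (add_comm _ _)) ?_
  rw [mul_left_comm, hu, mul_zero]

variable {k : ℕ} {A : Matrix (Fin 3) (Fin 3) K}

theorem mk_pow_eq_zero {ℓ : R3 K} (h : ℓ ^ k ∈ I) {a : ℕ} (ha : k ≤ a) :
    Ideal.Quotient.mk I ℓ ^ a = 0 := by
  rw [← map_pow, Ideal.Quotient.eq_zero_iff_mem]
  rw [← Nat.sub_add_cancel ha, pow_add]
  exact Ideal.mul_mem_left _ _ h

theorem quotComp_eq_bot (hA : IsUnit A.det) (h : ∀ t, linForm K (A t) ^ k ∈ I) {n : ℕ}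
    (hn : 3 * k ≤ n) : quotComp K I n = ⊥ := by
  refine le_bot_iff.1 (quotComp_le hA fun a b c habc => ?_)
  rw [Submodule.mem_bot]
  simp only [map_mul, map_pow]
  rcases (by omega : k ≤ a ∨ k ≤ b ∨ k ≤ c) with h' | h' | h' <;>
    simp [mk_pow_eq_zero (h _) h']

theorem surjective_mul_linForm (hA : IsUnit A.det) (h1 : linForm K (A 1) ^ k ∈ I)
    (h2 : linForm K (A 2) ^ k ∈ I) {n : ℕ} (hn : 2 * k ≤ n + 2) :
    ∀ v ∈ quotComp K I (n + 1), ∃ u ∈ quotComp K I n,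
      Ideal.Quotient.mk I (linForm K (A 0)) * u = v := by
  have : quotComp K I (n + 1) ≤ (quotComp K I n).map
      (LinearMap.mulLeft K (Ideal.Quotient.mk I (linForm K (A 0)))) := by
    refine quotComp_le hA fun a b c habc => ?_
    rcases Nat.eq_zero_or_pos a with rfl | ha
    · have : Ideal.Quotient.mk I
          (linForm K (A 0) ^ 0 * linForm K (A 1) ^ b * linForm K (A 2) ^ c) = 0 := by
        simp only [map_mul, map_pow]
        rcases (by omega : k ≤ b ∨ k ≤ c) with h' | h'
        · simp [mk_pow_eq_zero h1 h']
        · simp [mk_pow_eq_zero h2 h']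
      rw [this]
      exact zero_mem _
    · obtain ⟨a, rfl⟩ : ∃ a', a = a' + 1 := ⟨a - 1, by omega⟩
      refine ⟨_, mk_mem_quotComp (I := I) (d := n)
        (by simpa [show a + b + c = n by omega] using monomial_isHomogeneous A a b c), ?_⟩
      rw [LinearMap.mulLeft_apply, ← map_mul]
      congr 1
      ring
  exact this

theorem surjective_mul_linForm_pow (hA : IsUnit A.det) (h1 : linForm K (A 1) ^ k ∈ I)
    (h2 : linForm K (A 2) ^ k ∈ I) {n : ℕ} (hn : 2 * k ≤ n + 2) (j : ℕ) :
    ∀ v ∈ quotComp K I (n + j), ∃ u ∈ quotComp K I n,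
      Ideal.Quotient.mk I (linForm K (A 0)) ^ j * u = v := by
  induction j with
  | zero => intro v hv; exact ⟨v, hv, by simp⟩
  | succ j ih =>
    intro v hv
    obtain ⟨w, hw, rfl⟩ := surjective_mul_linForm hA h1 h2 (n := n + j) (by omega) v hv
    obtain ⟨u, hu, rfl⟩ := ih w hw
    exact ⟨u, hu, by ring⟩

/-- If multiplication by a form whose `k`-th power vanishes is injective in a high degree, then
the next component is zero. -/
theorem quotComp_succ_eq_bot (hA : IsUnit A.det) (h : ∀ t, linForm K (A t) ^ k ∈ I) {n : ℕ}
    (hn : 2 * k ≤ n + 2) (hinj : ∀ u ∈ quotComp K I n,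
      Ideal.Quotient.mk I (linForm K (A 0)) * u = 0 → u = 0) : quotComp K I (n + 1) = ⊥ := by
  have key (b : ℕ) : ∀ a c, a + b + c = n + 1 → Ideal.Quotient.mk I
      (linForm K (A 0) ^ a * linForm K (A 1) ^ b * linForm K (A 2) ^ c) = 0 := by
    induction b with
    | zero =>
      intro a c habc
      simp only [map_mul, map_pow]
      rcases (by omega : k ≤ a ∨ k ≤ c) with h' | h' <;> simp [mk_pow_eq_zero (h _) h']
    | succ b ih =>
      intro a c habc
      have h0 := ih (a + 1) c (by omega)
      have h1 := hinj (Ideal.Quotient.mk I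
        (linForm K (A 0) ^ a * linForm K (A 1) ^ b * linForm K (A 2) ^ c))
        (mk_mem_quotComp (by
          simpa [show a + b + c = n by omega] using monomial_isHomogeneous A a b c))
        (by rw [← map_mul, ← h0]; congr 1; ring)
      have h2 : Ideal.Quotient.mk I
          (linForm K (A 0) ^ a * linForm K (A 1) ^ (b + 1) * linForm K (A 2) ^ c) =
          Ideal.Quotient.mk I (linForm K (A 1)) * Ideal.Quotient.mk I
            (linForm K (A 0) ^ a * linForm K (A 1) ^ b * linForm K (A 2) ^ c) := by
        rw [← map_mul]; congr 1; ring
      rw [h2, h1, mul_zero]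
  exact le_bot_iff.1 (quotComp_le hA fun a b c habc => (Submodule.mem_bot K).2 (key b a c habc))

/-- Multiplication by the linear form with coefficient vector `v` on `[R/I]_n`. -/
def mulLinForm (I : Ideal (R3 K)) (v : Fin 3 → K) (n : ℕ) :
    quotComp K I n →ₗ[K] quotComp K I (n + 1) :=
  (LinearMap.mulLeft K (Ideal.Quotient.mk I (linForm K v))).restrict fun _ hx =>
    mk_mul_mem_quotComp (linForm_isHomogeneous v) hx (add_comm _ _)

theorem mulLinForm_injective_iff {v : Fin 3 → K} {n : ℕ} :
    Function.Injective (mulLinForm I v n) ↔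
      ∀ u ∈ quotComp K I n, Ideal.Quotient.mk I (linForm K v) * u = 0 → u = 0 := by
  rw [injective_iff_map_eq_zero]
  constructor
  · intro h u hu h0
    exact congrArg Subtype.val (h ⟨u, hu⟩ (Subtype.ext h0))
  · intro h u h0
    exact Subtype.ext (h u.1 u.2 (congrArg Subtype.val h0))

theorem mulLinForm_surjective_iff {v : Fin 3 → K} {n : ℕ} :
    Function.Surjective (mulLinForm I v n) ↔ ∀ w ∈ quotComp K I (n + 1),
      ∃ u ∈ quotComp K I n, Ideal.Quotient.mk I (linForm K v) * u = w := by
  constructor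
  · intro h w hw
    obtain ⟨u, hu⟩ := h ⟨w, hw⟩
    exact ⟨u.1, u.2, congrArg Subtype.val hu⟩
  · intro h w
    obtain ⟨u, hu, h'⟩ := h w.1 w.2
    exact ⟨⟨u, hu⟩, Subtype.ext h'⟩

theorem injective_mul_of_injective_mul {v w : Fin 3 → K} {n : ℕ}
    (hv : ∀ x ∈ quotComp K I (n + 1), ∃ u ∈ quotComp K I n,
      Ideal.Quotient.mk I (linForm K v) * u = x)
    (hv' : ∀ u ∈ quotComp K I n, Ideal.Quotient.mk I (linForm K v) * u = 0 → u = 0)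
    (hw : ∀ x ∈ quotComp K I (n + 1), ∃ u ∈ quotComp K I n,
      Ideal.Quotient.mk I (linForm K w) * u = x) :
    ∀ u ∈ quotComp K I n, Ideal.Quotient.mk I (linForm K w) * u = 0 → u = 0 := by
  have he := (LinearEquiv.ofBijective (mulLinForm I v n)
    ⟨mulLinForm_injective_iff.2 hv', mulLinForm_surjective_iff.2 hv⟩).finrank_eq
  exact mulLinForm_injective_iff.1
    ((LinearMap.injective_iff_surjective_of_finrank_eq_finrank he).2
      (mulLinForm_surjective_iff.2 hw))

theorem quotComp_zero_ne_bot (h : (1 : R3 K) ∉ I) : quotComp K I 0 ≠ ⊥ := by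
  intro hb
  have := mk_mem_quotComp (I := I) (isHomogeneous_one (Fin 3) K)
  rw [hb, Submodule.mem_bot, Ideal.Quotient.eq_zero_iff_mem] at this
  exact h this

theorem quotComp_eq_bot_of_le {m n : ℕ} (hmn : m ≤ n) (h : quotComp K I m = ⊥) :
    quotComp K I n = ⊥ := by
  induction n, hmn using Nat.le_induction with
  | base => exact h
  | succ n _ ih =>
    refine le_bot_iff.1 (quotComp_succ_le fun t x hx => ?_)
    rw [ih, Submodule.mem_bot] at hx
    simp [hx]

end Quotient

section GeneralPosition

/-- A polynomial expression whose nonvanishing forces general position. -/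
def positionPoly {R : Type*} [CommRing R] (c : Fin 5 → Fin 3 → R) : R :=
  letI M : Matrix (Fin 3) (Fin 3) R := Matrix.of ![c 0, c 1, c 2]
  M.det * (∏ t, Matrix.vecMul (c 3) M.adjugate t) * Matrix.vecMul (c 4) M.adjugate 0

theorem map_positionPoly {R S : Type*} [CommRing R] [CommRing S] (f : R →+* S)
    (c : Fin 5 → Fin 3 → R) : f (positionPoly c) = positionPoly fun i t => f (c i t) := by
  simp [positionPoly, Matrix.det_fin_three, Matrix.adjugate_fin_three, Matrix.vecMul, dotProduct,
    Fin.sum_univ_three, Fin.prod_univ_three]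

theorem positionPoly_standard {R : Type*} [CommRing R] :
    positionPoly (![![1, 0, 0], ![0, 1, 0], ![0, 0, 1], ![1, 1, 1], ![1, 1, 1]] :
      Fin 5 → Fin 3 → R) = 1 := by
  simp [positionPoly, Matrix.det_fin_three, Matrix.adjugate_fin_three, Matrix.vecMul, dotProduct,
    Fin.sum_univ_three, Fin.prod_univ_three]

variable {K : Type} [Field K]

theorem exists_coordinates {c₀ c₁ c₂ : Fin 3 → K}
    (hM : (Matrix.of ![c₀, c₁, c₂]).det ≠ 0) (v : Fin 3 → K) :
    ∃ w : Fin 3 → K, (∀ t, w t =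
      (Matrix.of ![c₀, c₁, c₂]).det⁻¹ * Matrix.vecMul v (Matrix.of ![c₀, c₁, c₂]).adjugate t) ∧
      v = w 0 • c₀ + w 1 • c₁ + w 2 • c₂ := by
  set M : Matrix (Fin 3) (Fin 3) K := Matrix.of ![c₀, c₁, c₂] with hMdef
  refine ⟨M.det⁻¹ • Matrix.vecMul v M.adjugate, fun t => rfl, ?_⟩
  have h : Matrix.vecMul (M.det⁻¹ • Matrix.vecMul v M.adjugate) M = v := by
    rw [Matrix.smul_vecMul, Matrix.vecMul_vecMul, Matrix.adjugate_mul, Matrix.vecMul_smul,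
      Matrix.vecMul_one, smul_smul, inv_mul_cancel₀ hM, one_smul]
  conv_lhs => rw [← h, Matrix.vecMul_eq_sum, Fin.sum_univ_three]
  rfl

theorem inGeneralPosition_of_positionPoly_ne_zero {c : Fin 5 → Fin 3 → K}
    (h : positionPoly c ≠ 0) : InGeneralPosition c := by
  simp only [positionPoly, ne_eq, mul_eq_zero, not_or, Fin.prod_univ_three] at h
  obtain ⟨⟨hM, ⟨h0, h1⟩, h2⟩, h4⟩ := h
  obtain ⟨w, hw, h3'⟩ := exists_coordinates hM (c 3)
  obtain ⟨v, hv, h4'⟩ := exists_coordinates hM (c 4)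
  refine ⟨isUnit_iff_ne_zero.2 hM, ⟨w 0, w 1, w 2, ?_, ?_, ?_, h3'⟩, ⟨v 0, v 1, v 2, ?_, h4'⟩⟩
  · rw [hw]; exact mul_ne_zero (inv_ne_zero hM) h0
  · rw [hw]; exact mul_ne_zero (inv_ne_zero hM) h1
  · rw [hw]; exact mul_ne_zero (inv_ne_zero hM) h2
  · rw [hv]; exact mul_ne_zero (inv_ne_zero hM) h4

theorem genericTuples_of_inGeneralPosition {P : (Fin 5 → Fin 3 → K) → Prop}
    (h : ∀ c, InGeneralPosition c → P c) : GenericTuples K 5 P := by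
  refine ⟨positionPoly fun i t => X (i, t), fun h0 => ?_, fun c hc =>
    h c (inGeneralPosition_of_positionPoly_ne_zero ?_)⟩
  · have := congrArg (MvPolynomial.eval fun p : Fin 5 × Fin 3 =>
      (![![1, 0, 0], ![0, 1, 0], ![0, 0, 1], ![1, 1, 1], ![1, 1, 1]] :
        Fin 5 → Fin 3 → K) p.1 p.2) h0
    rw [map_positionPoly, map_zero] at this
    simp only [MvPolynomial.eval_X] at this
    rw [positionPoly_standard] at this
    exact one_ne_zero this
  · rw [map_positionPoly] at hc
    simpa only [MvPolynomial.eval_X] using hc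

end GeneralPosition

section MaximalRank

variable {K : Type} [Field K] {c : Fin 5 → Fin 3 → K} {k : ℕ}

theorem pow_mem_powerIdeal (t : Fin 3) :
    linForm K ((Matrix.of ![c 0, c 1, c 2]) t) ^ k ∈ powerIdeal c k := by
  refine Ideal.subset_span ?_
  fin_cases t
  · exact Or.inl rfl
  · exact Or.inr (Or.inl rfl)
  · exact Or.inr (Or.inr (Or.inl rfl))

theorem one_notMem_powerIdeal (hk : 1 ≤ k) : (1 : R3 K) ∉ powerIdeal c k := by
  intro h
  obtain ⟨p, q, r, s, h⟩ := mem_span_four.1 h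
  have h0 (v : Fin 3 → K) : constantCoeff (linForm K v) = 0 := by simp [linForm]
  have := congrArg constantCoeff h
  simp [h0, Nat.one_le_iff_ne_zero.1 hk] at this

/-- Multiplication by the powers of the fifth form is surjective from degree `2 * k - 2` on. -/
theorem surjective_mul_fifth (hc : InGeneralPosition c) {n : ℕ} (hn : 2 * k ≤ n + 2) (j : ℕ) :
    ∀ v ∈ quotComp K (powerIdeal c k) (n + j), ∃ u ∈ quotComp K (powerIdeal c k) n,
      Ideal.Quotient.mk (powerIdeal c k) (linForm K (c 4)) ^ j * u = v := by
  obtain ⟨p, q, r, hp, h4⟩ := hc.exists_fifth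
  have hdet : IsUnit (Matrix.of ![c 4, c 1, c 2]).det := by
    have : Matrix.of ![c 4, c 1, c 2] =
        !![p, q, r; 0, 1, 0; 0, 0, 1] * Matrix.of ![c 0, c 1, c 2] := by
      ext i t
      rw [Matrix.mul_apply, Fin.sum_univ_three, h4]
      fin_cases i <;> simp
    rw [this, Matrix.det_mul]
    refine IsUnit.mul ?_ hc.isUnit_det
    rw [Matrix.det_fin_three]
    simp [hp]
  exact surjective_mul_linForm_pow hdet (pow_mem_powerIdeal 1) (pow_mem_powerIdeal 2) hn j

/-- Injectivity of a power of the fifth form on a component of degree at least `2 * k - 2` forces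
its target to vanish. -/
theorem quotComp_eq_bot_of_injective (hc : InGeneralPosition c) {n j : ℕ} (hn : 2 * k ≤ n + 2)
    (hj : 1 ≤ j) (h : ∀ u ∈ quotComp K (powerIdeal c k) n,
      Ideal.Quotient.mk (powerIdeal c k) (linForm K (c 4)) ^ j * u = 0 → u = 0) :
    quotComp K (powerIdeal c k) (n + j) = ⊥ := by
  refine quotComp_eq_bot_of_le (by omega : n + 1 ≤ n + j) (quotComp_succ_eq_bot hc.isUnit_det
    pow_mem_powerIdeal hn (injective_mul_of_injective_mul (v := c 4) ?_ ?_ ?_))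
  · simpa using surjective_mul_fifth hc hn 1
  · intro u hu h0
    refine h u hu ?_
    rw [← Nat.sub_add_cancel hj, pow_succ, mul_assoc, h0, mul_zero]
  · exact surjective_mul_linForm hc.isUnit_det (pow_mem_powerIdeal 1) (pow_mem_powerIdeal 2) hn

theorem injective_of_injective_of_le (hc : InGeneralPosition c) {m n : ℕ} (hmn : n ≤ m)
    (hm : m + 2 ≤ 2 * k) {g : R3 K ⧸ powerIdeal c k}
    (h : ∀ u ∈ quotComp K (powerIdeal c k) m, g * u = 0 → u = 0) :
    ∀ u ∈ quotComp K (powerIdeal c k) n, g * u = 0 → u = 0 := by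
  induction m, hmn using Nat.le_induction with
  | base => exact h
  | succ m _ ih =>
    exact ih (by omega)
      (injective_mul_of_socle (fun u hu => powerIdeal_socle hc (by omega) hu) h)

theorem mulMaxRank_powerIdeal (hc : InGeneralPosition c) {j : ℕ} (hk : 1 ≤ k) (hj : 1 ≤ j)
    {h hm : ℕ → ℕ} (hh : h = hilb K (powerIdeal c k))
    (hhm : hm = fun d => if j ≤ d then h (d - j) else 0) {a b : ℕ}
    (ha : a = sSup {d : ℕ | h d ≠ 0 ∧ hm d ≤ h d}) (hb : b = sInf {d : ℕ | hm d ≠ 0 ∧ h d ≤ hm d})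
    (hinj : ∀ u ∈ quotComp K (powerIdeal c k) (a - j),
      Ideal.Quotient.mk (powerIdeal c k) (linForm K (c 4)) ^ j * u = 0 → u = 0)
    (hsurj : ∀ v ∈ quotComp K (powerIdeal c k) b, ∃ u ∈ quotComp K (powerIdeal c k) (b - j),
      Ideal.Quotient.mk (powerIdeal c k) (linForm K (c 4)) ^ j * u = v) (i : ℕ) :
    mulMaxRank K (powerIdeal c k) (linForm K (c 4)) j i := by
  have hzero {d : ℕ} : h d = 0 ↔ quotComp K (powerIdeal c k) d = ⊥ := hh ▸ hilb_eq_zero_iff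
  have hbdd : BddAbove {d : ℕ | h d ≠ 0 ∧ hm d ≤ h d} := by
    refine ⟨3 * k, fun d hd => ?_⟩
    by_contra! hlt
    exact hd.1 (hzero.2 (quotComp_eq_bot hc.isUnit_det pow_mem_powerIdeal hlt.le))
  have hmem : a ∈ {d : ℕ | h d ≠ 0 ∧ hm d ≤ h d} := by
    rw [ha]
    refine Nat.sSup_mem ⟨0, ?_, ?_⟩ hbdd
    · exact fun h0 => quotComp_zero_ne_bot (one_notMem_powerIdeal hk) (hzero.1 h0)
    · simp [hhm, Nat.one_le_iff_ne_zero.1 hj]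
  rcases le_or_gt (2 * k) (i + 2) with hi | hi
  · exact Or.inr (surjective_mul_fifth hc hi j)
  rcases le_or_gt (i + j) a with hia | hia
  · rcases le_or_gt (a - j + 2) (2 * k) with hak | hak
    · exact Or.inl (injective_of_injective_of_le hc (by omega) hak hinj)
    · have := quotComp_eq_bot_of_injective hc hak.le hj hinj
      rw [Nat.sub_add_cancel (by omega)] at this
      exact absurd (hzero.2 this) hmem.1
  right
  by_cases h0 : h (i + j) = 0
  · intro v hv
    rw [hzero.1 h0, Submodule.mem_bot] at hv
    exact ⟨0, zero_mem _, by rw [hv, mul_zero]⟩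
  have hlt : h (i + j) < hm (i + j) := by
    by_contra! hle
    exact hia.not_ge (ha ▸ le_csSup hbdd ⟨h0, hle⟩)
  have hB : i + j ∈ {d : ℕ | hm d ≠ 0 ∧ h d ≤ hm d} := ⟨by omega, hlt.le⟩
  have hbi : b ≤ i + j := hb ▸ Nat.sInf_le hB
  have hjb : j ≤ b := by
    have hbmem : hm b ≠ 0 := (hb ▸ Nat.sInf_mem ⟨_, hB⟩ : b ∈ {d : ℕ | hm d ≠ 0 ∧ h d ≤ hm d}).1
    by_contra hjb
    exact hbmem (by simp [hhm, hjb])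
  have hbi' : b - j ≤ i := by omega
  rw [← Nat.sub_add_cancel hjb, Nat.add_sub_cancel] at hsurj
  generalize b - j = m at hsurj hbi'
  clear h0 hlt hB hbi hi hia
  induction i, hbi' using Nat.le_induction with
  | base => exact hsurj
  | succ i _ ih =>
    rw [Nat.add_right_comm]
    exact surjective_mul_succ ih

end MaximalRank

end FourPowers

/-- Let `k ≥ 3`, `j ≥ 2`.  For general linear forms `L₁, …, L₄, L` and
`I = (L₁^k, …, L₄^k)` with Hilbert function `h`, let
`a = max { d : h(d-j) ≤ h(d) }` and `b = min { d : h(d-j) ≥ h(d) }` (where `h` is regarded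
as zero in negative degrees, and the max/min is taken over degrees in the support of the
relevant value, which makes the max and min well defined).  If
`×L^j : [R/I]_{a-j} → [R/I]_a` is injective and `×L^j : [R/I]_{b-j} → [R/I]_b` is
surjective, then `×L^j : [R/I]_{d-j} → [R/I]_d` has maximal rank in every degree. -/
theorem stmt11 (K : Type) [Field K] [Infinite K] (k j : ℕ) (hk : 3 ≤ k) (hj : 2 ≤ j) :
    GenericTuples K 5 (fun c =>
      letI I : Ideal (R3 K) := Ideal.span
        {linForm K (c 0) ^ k, linForm K (c 1) ^ k, linForm K (c 2) ^ k, linForm K (c 3) ^ k}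
      letI L : R3 K := linForm K (c 4)
      letI h : ℕ → ℕ := hilb K I
      -- the Hilbert function in degree `d - j`, regarded as zero when `d < j`
      letI hm : ℕ → ℕ := fun d => if j ≤ d then h (d - j) else 0
      letI a : ℕ := sSup {d : ℕ | h d ≠ 0 ∧ hm d ≤ h d}
      letI b : ℕ := sInf {d : ℕ | hm d ≠ 0 ∧ h d ≤ hm d}
      -- injectivity of ×L^j : [R/I]_{a-j} → [R/I]_a
      (∀ u ∈ quotComp K I (a - j), Ideal.Quotient.mk I L ^ j * u = 0 → u = 0) →
      -- surjectivity of ×L^j : [R/I]_{b-j} → [R/I]_b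
      (∀ v ∈ quotComp K I b, ∃ u ∈ quotComp K I (b - j),
        Ideal.Quotient.mk I L ^ j * u = v) →
      -- then ×L^j has maximal rank in every degree
      ∀ d : ℕ, mulMaxRank K I L j d) := by
  refine FourPowers.genericTuples_of_inGeneralPosition fun c hc => ?_
  intro hinj hsurj
  exact FourPowers.mulMaxRank_powerIdeal hc (by omega) (by omega) rfl rfl rfl rfl hinj hsurj
end
end

section
/- Let k ≥ 3 and let P_1,…,P_5 be five general points in the projective plane P^2 over an infinite field k, with homogeneous ideals ℘_1,…,℘_5 ⊆ R = k[x,y,z]. Then the vector space [℘_1^{k−1} ∩ … ∩ ℘_5^{k−1}]_{2k−2} of forms of degree 2k−2 vanishing to order at least k−1 at each of the five points is 1-dimensional (spanned by C^{k−1}, where C is the unique conic through the five points). -/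
open MvPolynomial

noncomputable section

/-- The homogeneous (prime) ideal of the point of `ℙ²` with homogeneous coordinate vector
`p`: the ideal generated by the linear forms vanishing at `p`. -/
def pointIdeal (K : Type) [Field K] (p : Fin 3 → K) : Ideal (R3 K) :=
  Ideal.span {f : R3 K |
    f ∈ MvPolynomial.homogeneousSubmodule (Fin 3) K 1 ∧ MvPolynomial.eval p f = 0}

/-- The degree-`d` homogeneous component `[I]_d` of an ideal `I ⊆ R`, as a `K`-vector
subspace of `R`. -/
def idealComp (K : Type) [Field K] (I : Ideal (R3 K)) (d : ℕ) : Submodule K (R3 K) :=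
  Submodule.restrictScalars K I ⊓ MvPolynomial.homogeneousSubmodule (Fin 3) K d

open scoped Matrix

namespace MvPolynomial

variable {K σ A : Type*} [Field K] [CommRing A] [Algebra K A]

theorem aeval_mul_of_isHomogeneous {f : MvPolynomial σ K} {d : ℕ} (hf : f.IsHomogeneous d)
    (a : A) (v : σ → A) :
    aeval (fun i => a * v i) f = a ^ d * aeval v f := by
  rw [aeval_def, aeval_def, eval₂_eq, eval₂_eq, Finset.mul_sum]
  refine Finset.sum_congr rfl fun m hm => ?_
  have hd : ∑ i ∈ m.support, m i = d :=
    (hf.degree_eq_sum_deg_support hm).symm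
  simp only [mul_pow, Finset.prod_mul_distrib, Finset.prod_pow_eq_pow_sum, hd]
  ring

theorem eval_mul_of_isHomogeneous {f : MvPolynomial σ K} {d : ℕ} (hf : f.IsHomogeneous d)
    (a : K) (v : σ → K) :
    eval (fun i => a * v i) f = a ^ d * eval v f := by
  simpa [aeval_eq_eval] using aeval_mul_of_isHomogeneous hf a v

theorem aeval_add_mul_of_isHomogeneous {l : MvPolynomial σ K} (hl : l.IsHomogeneous 1)
    (c s : A) (u g : σ → A) :
    aeval (fun i => c * u i + s * g i) l = c * aeval u l + s * aeval g l := by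
  have hl' : l ∈ Submodule.span K (Set.range (X : σ → MvPolynomial σ K)) := by
    rw [← homogeneousSubmodule_one_eq_span_X]
    exact hl
  induction hl' using Submodule.span_induction with
  | mem x hx =>
    obtain ⟨i, rfl⟩ := hx
    simp
  | zero => simp
  | add x y hx hy ihx ihy =>
    rw [← homogeneousSubmodule_one_eq_span_X] at hx hy
    rw [map_add, map_add, map_add, ihx hx, ihy hy]
    ring
  | smul a x hx ih =>
    rw [← homogeneousSubmodule_one_eq_span_X] at hx
    rw [map_smul, map_smul, map_smul, ih hx, smul_add, mul_smul_comm, mul_smul_comm]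

theorem aeval_algebraMap_eq (f : MvPolynomial σ K) (v : σ → K) :
    aeval (fun i => algebraMap K A (v i)) f = algebraMap K A (eval v f) := by
  have := aeval_algebraMap_apply A v f
  rwa [aeval_eq_eval] at this

theorem isHomogeneous_of_monomial_mul {f : MvPolynomial σ K} {m : σ →₀ ℕ} {d : ℕ}
    (h : (monomial m (1 : K) * f).IsHomogeneous (m.degree + d)) : f.IsHomogeneous d := by
  intro e he
  have := h (d := m + e) (by rwa [coeff_monomial_mul, one_mul])
  rw [map_add] at this
  have hm : Finsupp.weight 1 m = m.degree := (DFunLike.congr_fun Finsupp.degree_eq_weight_one m).symm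
  rw [hm] at this
  exact Nat.add_left_cancel this

end MvPolynomial

theorem pow_dvd_aeval_of_mem_pointIdeal_pow {K : Type} [Field K] {A : Type*} [CommRing A]
    [Algebra K A] {p : Fin 3 → K} {n : ℕ} {F : R3 K} (hF : F ∈ pointIdeal K p ^ n)
    (c s : A) (g : Fin 3 → A) :
    s ^ n ∣ aeval (fun t => c * algebraMap K A (p t) + s * g t) F := by
  rw [← Ideal.mem_span_singleton, ← Ideal.span_singleton_pow]
  have hle : (pointIdeal K p).map (aeval (fun t => c * algebraMap K A (p t) + s * g t) :
      R3 K →ₐ[K] A) ≤ Ideal.span {s} := by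
    rw [pointIdeal, Ideal.map_span, Ideal.span_le]
    rintro _ ⟨l, ⟨hl, hlp⟩, rfl⟩
    have h0 : aeval (fun t => algebraMap K A (p t)) l = 0 := by
      rw [aeval_algebraMap_eq, hlp, map_zero]
    rw [SetLike.mem_coe, Ideal.mem_span_singleton]
    have h1 := aeval_add_mul_of_isHomogeneous hl c s (fun t => algebraMap K A (p t)) g
    rw [h0, mul_zero, zero_add] at h1
    exact ⟨_, h1⟩
  have := Ideal.mem_map_of_mem (aeval (fun t => c * algebraMap K A (p t) + s * g t) :
      R3 K →ₐ[K] A) hF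
  rw [Ideal.map_pow] at this
  exact Ideal.pow_right_mono hle n this

theorem mem_pointIdeal_of_eval_eq_zero {K : Type} [Field K] {p : Fin 3 → K} (hp : p ≠ 0)
    {d : ℕ} {f : R3 K} (hf : f.IsHomogeneous d) (h : eval p f = 0) :
    f ∈ pointIdeal K p := by
  obtain ⟨j, hj⟩ := Function.ne_iff.mp hp
  have hX : ∀ i, Ideal.Quotient.mkₐ K (pointIdeal K p) (C (p j) * X i) =
      Ideal.Quotient.mkₐ K (pointIdeal K p) (X j * C (p i)) := by
    intro i
    refine Ideal.Quotient.eq.mpr (Ideal.subset_span ⟨?_, ?_⟩)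
    · refine ((isHomogeneous_C_mul_X _ _).sub ?_)
      rw [mul_comm]
      exact isHomogeneous_C_mul_X _ _
    · simp [mul_comm]
  have h1 := aeval_mul_of_isHomogeneous hf (C (p j) : R3 K) X
  have h2 := aeval_mul_of_isHomogeneous hf (X j : R3 K) (fun i => C (p i))
  have h3 : aeval (fun i => (C (p i) : R3 K)) f = 0 := by
    have := aeval_algebraMap_eq (A := R3 K) f p
    rwa [h, map_zero] at this
  rw [aeval_X_left_apply] at h1
  rw [h3, mul_zero] at h2
  have h4 : Ideal.Quotient.mkₐ K (pointIdeal K p) (C (p j) ^ d * f) = 0 := by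
    rw [← h1, ← map_zero (Ideal.Quotient.mkₐ K (pointIdeal K p)), ← h2, comp_aeval_apply,
      comp_aeval_apply]
    simp only [hX]
  have h5 : C (p j) ^ d * f ∈ pointIdeal K p := Ideal.Quotient.eq_zero_iff_mem.mp h4
  have h6 := Ideal.mul_mem_left _ (C ((p j)⁻¹ ^ d)) h5
  rwa [← mul_assoc, ← C_pow, ← C_mul, ← mul_pow, inv_mul_cancel₀ hj, one_pow, C_1, one_mul] at h6

/-- The standard quadratic Cremona map of `ℙ²` in the projective frame `p₀, p₁, p₂`, with values
in a `K`-algebra. -/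
def cremona {K : Type} [Field K] {A : Type*} [CommRing A] [Algebra K A] (p₀ p₁ p₂ : Fin 3 → K)
    (v : Fin 3 → A) (t : Fin 3) : A :=
  algebraMap K A (p₀ t) * (v 1 * v 2) + algebraMap K A (p₁ t) * (v 0 * v 2) +
    algebraMap K A (p₂ t) * (v 0 * v 1)

theorem map_cremona {K : Type} [Field K] {A B : Type*} [CommRing A] [Algebra K A] [CommRing B]
    [Algebra K B] (φ : A →ₐ[K] B) (p₀ p₁ p₂ : Fin 3 → K) (v : Fin 3 → A) (t : Fin 3) :
    φ (cremona p₀ p₁ p₂ v t) = cremona p₀ p₁ p₂ (fun i => φ (v i)) t := by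
  simp [cremona]

theorem exists_aeval_cremona_eq {K : Type} [Field K] {p₀ p₁ p₂ : Fin 3 → K} {n : ℕ} {F : R3 K}
    (hF : F.IsHomogeneous (2 * n)) (h₀ : F ∈ pointIdeal K p₀ ^ n)
    (h₁ : F ∈ pointIdeal K p₁ ^ n) (h₂ : F ∈ pointIdeal K p₂ ^ n) :
    ∃ G : R3 K, G.IsHomogeneous n ∧
      aeval (cremona p₀ p₁ p₂ (X : Fin 3 → R3 K)) F = (X 0 * X 1 * X 2) ^ n * G := by
  have d₀ := pow_dvd_aeval_of_mem_pointIdeal_pow h₀ (X 1 * X 2 : R3 K) (X 0)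
    (fun t => C (p₁ t) * X 2 + C (p₂ t) * X 1)
  have d₁ := pow_dvd_aeval_of_mem_pointIdeal_pow h₁ (X 0 * X 2 : R3 K) (X 1)
    (fun t => C (p₀ t) * X 2 + C (p₂ t) * X 0)
  have d₂ := pow_dvd_aeval_of_mem_pointIdeal_pow h₂ (X 0 * X 1 : R3 K) (X 2)
    (fun t => C (p₀ t) * X 1 + C (p₁ t) * X 0)
  have e₀ : (fun t => (X 1 * X 2 : R3 K) * algebraMap K (R3 K) (p₀ t) +
      X 0 * (C (p₁ t) * X 2 + C (p₂ t) * X 1)) = cremona p₀ p₁ p₂ X := by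
    funext t; simp only [cremona, algebraMap_eq]; ring
  have e₁ : (fun t => (X 0 * X 2 : R3 K) * algebraMap K (R3 K) (p₁ t) +
      X 1 * (C (p₀ t) * X 2 + C (p₂ t) * X 0)) = cremona p₀ p₁ p₂ X := by
    funext t; simp only [cremona, algebraMap_eq]; ring
  have e₂ : (fun t => (X 0 * X 1 : R3 K) * algebraMap K (R3 K) (p₂ t) +
      X 2 * (C (p₀ t) * X 1 + C (p₁ t) * X 0)) = cremona p₀ p₁ p₂ X := by
    funext t; simp only [cremona, algebraMap_eq]; ring
  rw [e₀] at d₀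
  rw [e₁] at d₁
  rw [e₂] at d₂
  have nd : ∀ i j : Fin 3, i ≠ j → ¬ (X i : R3 K) ∣ X j ^ n := fun i j hij h =>
    hij (X_dvd_X.mp (X_prime.dvd_of_dvd_pow h))
  obtain ⟨G₀, hG₀⟩ := d₀
  rw [hG₀] at d₁
  obtain ⟨G₁, rfl⟩ := X_prime.pow_dvd_of_dvd_mul_left n (nd 1 0 (by decide)) d₁
  rw [hG₀] at d₂
  obtain ⟨G, rfl⟩ := X_prime.pow_dvd_of_dvd_mul_left n (nd 2 1 (by decide))
    (X_prime.pow_dvd_of_dvd_mul_left n (nd 2 0 (by decide)) d₂)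
  have hG : aeval (cremona p₀ p₁ p₂ (X : Fin 3 → R3 K)) F = (X 0 * X 1 * X 2) ^ n * G := by
    rw [hG₀]; ring
  refine ⟨G, ?_, hG⟩
  have hX : ∀ (a : K) (i j : Fin 3), (C a * (X i * X j) : R3 K).IsHomogeneous 2 := fun a i j =>
    ((isHomogeneous_X K i).mul (isHomogeneous_X K j)).C_mul a
  have hom := hF.aeval (S := K) (cremona p₀ p₁ p₂ (X : Fin 3 → R3 K)) (n := 2) fun t =>
    ((hX _ _ _).add (hX _ _ _)).add (hX _ _ _)
  rw [hG] at hom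
  refine isHomogeneous_of_monomial_mul
    (m := Finsupp.single 0 n + Finsupp.single 1 n + Finsupp.single 2 n) ?_
  have hm : (monomial (Finsupp.single 0 n + Finsupp.single 1 n + Finsupp.single 2 n) 1 : R3 K) =
      (X 0 * X 1 * X 2) ^ n := by
    rw [mul_pow, mul_pow, X_pow_eq_monomial, X_pow_eq_monomial, X_pow_eq_monomial,
      monomial_mul, monomial_mul, one_mul, one_mul]
  rw [hm]
  convert hom using 1
  simp only [map_add, Finsupp.degree_single]
  ring

theorem eval_add_mul_eq_of_mem_pointIdeal_pow {K : Type} [Field K] [Infinite K]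
    {p₀ p₁ p₂ p Q : Fin 3 → K} {n : ℕ} {F G : R3 K} (hG : G.IsHomogeneous n)
    (hFG : aeval (cremona p₀ p₁ p₂ (X : Fin 3 → R3 K)) F = (X 0 * X 1 * X 2) ^ n * G)
    (hF : F ∈ pointIdeal K p ^ n) {m : K} (hQp : ∀ t, cremona p₀ p₁ p₂ Q t = m * p t)
    (hQ : ∀ i, Q i ≠ 0) (s : K) (v : Fin 3 → K) :
    eval (fun i => s * Q i + v i) G = eval v G := by
  have hθ := congrArg (aeval fun i => (Polynomial.C (Q i) + Polynomial.X * Polynomial.C (v i))) hFG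
  rw [comp_aeval_apply] at hθ
  simp only [map_cremona, aeval_X, map_mul, map_pow] at hθ
  obtain ⟨g, hg⟩ : ∃ g : Fin 3 → Polynomial K,
      cremona p₀ p₁ p₂ (fun i => Polynomial.C (Q i) + Polynomial.X * Polynomial.C (v i)) =
        fun t => Polynomial.C m * algebraMap K (Polynomial K) (p t) + Polynomial.X * g t := by
    refine ⟨fun t =>
      Polynomial.C (p₀ t) * (Polynomial.C (Q 1) * Polynomial.C (v 2) +
        Polynomial.C (Q 2) * Polynomial.C (v 1) +
        Polynomial.X * Polynomial.C (v 1) * Polynomial.C (v 2)) +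
      Polynomial.C (p₁ t) * (Polynomial.C (Q 0) * Polynomial.C (v 2) +
        Polynomial.C (Q 2) * Polynomial.C (v 0) +
        Polynomial.X * Polynomial.C (v 0) * Polynomial.C (v 2)) +
      Polynomial.C (p₂ t) * (Polynomial.C (Q 0) * Polynomial.C (v 1) +
        Polynomial.C (Q 1) * Polynomial.C (v 0) +
        Polynomial.X * Polynomial.C (v 0) * Polynomial.C (v 1)), ?_⟩
    funext t
    have := congrArg (Polynomial.C (R := K)) (hQp t)
    simp only [cremona, Algebra.algebraMap_self, RingHom.id_apply, Polynomial.C_add,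
      Polynomial.C_mul] at this
    rw [Polynomial.algebraMap_eq, ← this]
    simp only [cremona, Polynomial.algebraMap_eq]
    ring
  have hdvd := pow_dvd_aeval_of_mem_pointIdeal_pow hF (Polynomial.C m) Polynomial.X g
  rw [← hg] at hdvd
  change aeval (cremona p₀ p₁ p₂ fun i => _) F = _ at hθ
  rw [hθ] at hdvd
  have hnd : ¬ Polynomial.X ∣ ((Polynomial.C (Q 0) + Polynomial.X * Polynomial.C (v 0)) *
      (Polynomial.C (Q 1) + Polynomial.X * Polynomial.C (v 1)) *
      (Polynomial.C (Q 2) + Polynomial.X * Polynomial.C (v 2))) ^ n := by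
    intro h
    have h' := Polynomial.prime_X.dvd_of_dvd_pow h
    rw [Polynomial.X_dvd_iff] at h'
    simp [Polynomial.mul_coeff_zero, hQ] at h'
  obtain ⟨q, hq⟩ := Polynomial.prime_X.pow_dvd_of_dvd_mul_left n hnd hdvd
  have hdeg := aeval_natDegree_le (n := 1) G hG.totalDegree_le
    (fun i => Polynomial.C (Q i) + Polynomial.X * Polynomial.C (v i)) fun i => by
      compute_degree
  have hq0 : q.natDegree = 0 := by
    by_cases h0 : q = 0
    · simp [h0]
    · rw [hq, Polynomial.natDegree_mul (pow_ne_zero _ Polynomial.X_ne_zero) h0,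
        Polynomial.natDegree_X_pow] at hdeg
      omega
  obtain ⟨c, rfl⟩ := Polynomial.natDegree_eq_zero.mp hq0
  have heval : ∀ t, eval (fun i => Q i + t * v i) G = t ^ n * c := by
    intro t
    have := congrArg (Polynomial.aeval t) hq
    rw [comp_aeval_apply] at this
    simp only [map_add, map_mul, map_pow, Polynomial.aeval_C, Polynomial.aeval_X,
      Algebra.algebraMap_self, RingHom.id_apply, aeval_eq_eval] at this
    exact this
  have hne : ∀ s, s ≠ 0 → eval (fun i => s * Q i + v i) G = c := by
    intro s hs
    have := eval_mul_of_isHomogeneous hG s (fun i => Q i + s⁻¹ * v i)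
    rw [heval, ← mul_assoc, ← mul_pow, mul_inv_cancel₀ hs, one_pow, one_mul] at this
    rw [← this]
    congr 2
    funext i
    field_simp
  have hr : ∀ s, (aeval (fun i => Polynomial.X * Polynomial.C (Q i) + Polynomial.C (v i))
      G).eval s = eval (fun i => s * Q i + v i) G := by
    intro s
    rw [← Polynomial.coe_aeval_eq_eval, comp_aeval_apply]
    simp only [map_add, map_mul, Polynomial.aeval_C, Polynomial.aeval_X, Algebra.algebraMap_self,
      RingHom.id_apply, aeval_eq_eval]
  have hconst : aeval (fun i => Polynomial.X * Polynomial.C (Q i) + Polynomial.C (v i)) G =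
      Polynomial.C c := by
    refine mul_left_cancel₀ Polynomial.X_ne_zero (Polynomial.funext fun s => ?_)
    by_cases hs : s = 0
    · simp [hs]
    · rw [Polynomial.eval_mul, Polynomial.eval_mul, hr, hne s hs, Polynomial.eval_C]
  have hall : ∀ s, eval (fun i => s * Q i + v i) G = c := fun s => by
    rw [← hr, hconst, Polynomial.eval_C]
  have h0 := hall 0
  simp only [zero_mul, zero_add] at h0
  rw [hall, ← h0]

theorem pow_mul_eval_eq {K : Type} [Field K] {G : R3 K} {n : ℕ} (hG : G.IsHomogeneous n)
    {Q Q' : Fin 3 → K} (hQ : ∀ s v, eval (fun i => s * Q i + v i) G = eval v G)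
    (hQ' : ∀ s v, eval (fun i => s * Q' i + v i) G = eval v G) (v : Fin 3 → K) :
    (Q 0 * Q' 1 - Q 1 * Q' 0) ^ n * eval v G =
      ((Q 1 * Q' 2 - Q 2 * Q' 1) * v 0 + (Q 2 * Q' 0 - Q 0 * Q' 2) * v 1 +
        (Q 0 * Q' 1 - Q 1 * Q' 0) * v 2) ^ n * eval (Pi.single 2 1) G := by
  rw [← eval_mul_of_isHomogeneous hG, ← eval_mul_of_isHomogeneous hG, ← hQ' (Q 1 * v 0 - Q 0 * v 1),
    ← hQ (v 1 * Q' 0 - v 0 * Q' 1)]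
  congr 2
  funext i
  fin_cases i <;> simp <;> ring

theorem isHomogeneous_linForm {K : Type} [Field K] (u : Fin 3 → K) :
    (linForm K u).IsHomogeneous 1 :=
  IsHomogeneous.sum _ _ _ fun i _ => isHomogeneous_C_mul_X (u i) i

theorem eval_linForm {K : Type} [Field K] (u v : Fin 3 → K) :
    eval v (linForm K u) = u ⬝ᵥ v := by
  simp [linForm, dotProduct]

section Frame

variable {A : Type*} [CommRing A]

/-- The coordinates of `v` in the frame `p₀, p₁, p₂`, scaled by the determinant of the frame. -/
def frameCoord (p₀ p₁ p₂ v : Fin 3 → A) : Fin 3 → A :=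
  ![(p₁ ⨯₃ p₂) ⬝ᵥ v, (p₂ ⨯₃ p₀) ⬝ᵥ v, (p₀ ⨯₃ p₁) ⬝ᵥ v]

/-- The image of `a` under the standard quadratic Cremona involution. -/
def cremonaInv (a : Fin 3 → A) : Fin 3 → A := ![a 1 * a 2, a 0 * a 2, a 0 * a 1]

theorem cremona_cremonaInv_frameCoord {K : Type} [Field K] (p₀ p₁ p₂ v : Fin 3 → K) (t : Fin 3) :
    cremona p₀ p₁ p₂ (cremonaInv (frameCoord p₀ p₁ p₂ v)) t =
      frameCoord p₀ p₁ p₂ v 0 * frameCoord p₀ p₁ p₂ v 1 * frameCoord p₀ p₁ p₂ v 2 *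
        ((p₀ ⨯₃ p₁) ⬝ᵥ p₂) * v t := by
  fin_cases t <;>
    simp [cremona, cremonaInv, frameCoord, cross_apply, dotProduct, Fin.sum_univ_three] <;> ring

theorem frameCoord_cremona {K : Type} [Field K] (p₀ p₁ p₂ v : Fin 3 → K) (i : Fin 3) :
    frameCoord p₀ p₁ p₂ (cremona p₀ p₁ p₂ v) i = ((p₀ ⨯₃ p₁) ⬝ᵥ p₂) * cremonaInv v i := by
  fin_cases i <;>
    simp [cremona, cremonaInv, frameCoord, cross_apply, dotProduct, Fin.sum_univ_three] <;> ring

/-- The product of the brackets whose nonvanishing makes five vectors sufficiently general: the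
first three form a frame, the other two have nonzero coordinates in it, and the line joining the
latter misses the third point. -/
def bracketProduct (c : Fin 5 → Fin 3 → A) : A :=
  ((c 0 ⨯₃ c 1) ⬝ᵥ c 2) *
    ((∏ i, frameCoord (c 0) (c 1) (c 2) (c 3) i) * (∏ i, frameCoord (c 0) (c 1) (c 2) (c 4) i)) *
    (frameCoord (c 0) (c 1) (c 2) (c 3) 0 * frameCoord (c 0) (c 1) (c 2) (c 4) 1 -
      frameCoord (c 0) (c 1) (c 2) (c 3) 1 * frameCoord (c 0) (c 1) (c 2) (c 4) 0)

theorem map_bracketProduct {B : Type*} [CommRing B] (φ : A →+* B) (c : Fin 5 → Fin 3 → A) :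
    φ (bracketProduct c) = bracketProduct fun i t => φ (c i t) := by
  simp [bracketProduct, frameCoord, cross_apply, dotProduct, Fin.sum_univ_three,
    Fin.prod_univ_three]

end Frame

theorem exists_bracketProduct_ne_zero (K : Type) [Field K] [Infinite K] :
    ∃ c : Fin 5 → Fin 3 → K, bracketProduct c ≠ 0 := by
  classical
  obtain ⟨u, hu⟩ := Infinite.exists_notMem_finset ({0, 1} : Finset K)
  simp only [Finset.mem_insert, Finset.mem_singleton, not_or] at hu
  refine ⟨![![1, 0, 0], ![0, 1, 0], ![0, 0, 1], ![1, 1, 1], ![1, u, 1]], ?_⟩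
  simp [bracketProduct, frameCoord, cross_apply, dotProduct, Fin.sum_univ_three,
    Fin.prod_univ_three, hu.1, sub_eq_zero, hu.2]

/-- The conic through the frame `p₀, p₁, p₂` whose strict transform under the Cremona map is the
line joining `Q` and `Q'`. -/
def cremonaConic (K : Type) [Field K] (p₀ p₁ p₂ Q Q' : Fin 3 → K) : R3 K :=
  C ((Q ⨯₃ Q') 0) * (linForm K (p₂ ⨯₃ p₀) * linForm K (p₀ ⨯₃ p₁)) +
    C ((Q ⨯₃ Q') 1) * (linForm K (p₁ ⨯₃ p₂) * linForm K (p₀ ⨯₃ p₁)) +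
    C ((Q ⨯₃ Q') 2) * (linForm K (p₁ ⨯₃ p₂) * linForm K (p₂ ⨯₃ p₀))

section Conic

variable {K : Type} [Field K] {p₀ p₁ p₂ Q Q' : Fin 3 → K}

theorem isHomogeneous_cremonaConic : (cremonaConic K p₀ p₁ p₂ Q Q').IsHomogeneous 2 := by
  have h : ∀ (a : K) (u v : Fin 3 → K),
      (C a * (linForm K u * linForm K v)).IsHomogeneous 2 := fun a u v =>
    ((isHomogeneous_linForm u).mul (isHomogeneous_linForm v)).C_mul a
  exact ((h _ _ _).add (h _ _ _)).add (h _ _ _)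

theorem eval_cremonaConic (v : Fin 3 → K) :
    eval v (cremonaConic K p₀ p₁ p₂ Q Q') =
      (Q ⨯₃ Q') ⬝ᵥ cremonaInv (frameCoord p₀ p₁ p₂ v) := by
  simp only [cremonaConic, map_add, map_mul, eval_C, eval_linForm]
  simp [cremonaInv, frameCoord, dotProduct, Fin.sum_univ_three]

theorem eval_cremona_cremonaConic (v : Fin 3 → K) :
    eval (cremona p₀ p₁ p₂ v) (cremonaConic K p₀ p₁ p₂ Q Q') =
      ((p₀ ⨯₃ p₁) ⬝ᵥ p₂) ^ 2 * (v 0 * v 1 * v 2) * ((Q ⨯₃ Q') ⬝ᵥ v) := by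
  rw [eval_cremonaConic]
  simp only [cremonaInv, frameCoord_cremona, dotProduct, Fin.sum_univ_three, Matrix.cons_val]
  ring

theorem cremonaConic_ne_zero (hp : (p₀ ⨯₃ p₁) ⬝ᵥ p₂ ≠ 0) (hQ : (Q ⨯₃ Q') 2 ≠ 0) :
    cremonaConic K p₀ p₁ p₂ Q Q' ≠ 0 := by
  intro h
  have h1 := eval_cremonaConic (Q := Q) (Q' := Q') (p₀ := p₀) (p₁ := p₁) (p₂ := p₂) (p₀ + p₁)
  have h2 : (Q ⨯₃ Q') ⬝ᵥ cremonaInv (frameCoord p₀ p₁ p₂ (p₀ + p₁)) =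
      (Q ⨯₃ Q') 2 * ((p₀ ⨯₃ p₁) ⬝ᵥ p₂) ^ 2 := by
    simp [cremonaInv, frameCoord, dotProduct, Fin.sum_univ_three, cross_apply]
    ring
  rw [h, h2, map_zero] at h1
  exact mul_ne_zero hQ (pow_ne_zero 2 hp) h1.symm

theorem exists_eq_C_mul_cremonaConic_pow [Infinite K] {q q' : Fin 3 → K} {n : ℕ} {F : R3 K}
    (hF : F.IsHomogeneous (2 * n)) (h₀ : F ∈ pointIdeal K p₀ ^ n)
    (h₁ : F ∈ pointIdeal K p₁ ^ n) (h₂ : F ∈ pointIdeal K p₂ ^ n)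
    (hq : F ∈ pointIdeal K q ^ n) (hq' : F ∈ pointIdeal K q' ^ n)
    (hp : (p₀ ⨯₃ p₁) ⬝ᵥ p₂ ≠ 0)
    (hQ : Q = cremonaInv (frameCoord p₀ p₁ p₂ q)) (hQ0 : ∀ i, Q i ≠ 0)
    (hQ' : Q' = cremonaInv (frameCoord p₀ p₁ p₂ q')) (hQ0' : ∀ i, Q' i ≠ 0)
    (hQQ' : (Q ⨯₃ Q') 2 ≠ 0) :
    ∃ a : K, F = C a * cremonaConic K p₀ p₁ p₂ Q Q' ^ n := by
  obtain ⟨G, hG, hFG⟩ := exists_aeval_cremona_eq hF h₀ h₁ h₂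
  have hGv := pow_mul_eval_eq hG
    (eval_add_mul_eq_of_mem_pointIdeal_pow hG hFG hq
      (fun t => hQ ▸ cremona_cremonaInv_frameCoord p₀ p₁ p₂ q t) hQ0)
    (eval_add_mul_eq_of_mem_pointIdeal_pow hG hFG hq'
      (fun t => hQ' ▸ cremona_cremonaInv_frameCoord p₀ p₁ p₂ q' t) hQ0')
  set g := eval (Pi.single 2 1) G
  set Δ := (p₀ ⨯₃ p₁) ⬝ᵥ p₂ with hΔ
  set D := (Q ⨯₃ Q') 2 with hD
  have hcr : ∀ v : Fin 3 → K, (Δ ^ 2) ^ n * D ^ n * eval (cremona p₀ p₁ p₂ v) F =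
      g * eval (cremona p₀ p₁ p₂ v) (cremonaConic K p₀ p₁ p₂ Q Q') ^ n := by
    intro v
    have h1 := congrArg (aeval v) hFG
    rw [comp_aeval_apply] at h1
    simp only [map_cremona, aeval_X, map_mul, map_pow] at h1
    change eval (cremona p₀ p₁ p₂ v) F = _ ^ n * eval v G at h1
    have h2 : D ^ n * eval v G = ((Q ⨯₃ Q') ⬝ᵥ v) ^ n * g := by
      simpa [hD, cross_apply, dotProduct, Fin.sum_univ_three] using hGv v
    rw [h1, eval_cremona_cremonaConic, ← hΔ]
    simp only [mul_pow]
    linear_combination (Δ ^ 2) ^ n * (v 0 ^ n * v 1 ^ n * v 2 ^ n) * h2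
  have hl : ∀ {u w : Fin 3 → K}, u ⬝ᵥ w = Δ → linForm K u ≠ 0 := by
    intro u w huw h
    have := eval_linForm u w
    rw [h, map_zero, huw] at this
    exact hp this.symm
  have hl₀ : linForm K (p₁ ⨯₃ p₂) ≠ 0 := hl (w := p₀) (by
    simp [hΔ, cross_apply, dotProduct, Fin.sum_univ_three]; ring)
  have hl₁ : linForm K (p₂ ⨯₃ p₀) ≠ 0 := hl (w := p₁) (by
    simp [hΔ, cross_apply, dotProduct, Fin.sum_univ_three]; ring)
  have hl₂ : linForm K (p₀ ⨯₃ p₁) ≠ 0 := hl (w := p₂) rfl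
  have hm : linForm K (p₁ ⨯₃ p₂) * linForm K (p₂ ⨯₃ p₀) * linForm K (p₀ ⨯₃ p₁) * C Δ ≠ 0 :=
    mul_ne_zero (mul_ne_zero (mul_ne_zero hl₀ hl₁) hl₂) (by simpa using hp)
  have hFC : C ((Δ ^ 2) ^ n * D ^ n) * F = C g * cremonaConic K p₀ p₁ p₂ Q Q' ^ n := by
    refine mul_left_cancel₀ (pow_ne_zero (2 * n) hm) (MvPolynomial.funext fun v => ?_)
    have h1 := hcr (cremonaInv (frameCoord p₀ p₁ p₂ v))
    rw [funext (cremona_cremonaInv_frameCoord p₀ p₁ p₂ v), eval_mul_of_isHomogeneous hF,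
      eval_mul_of_isHomogeneous isHomogeneous_cremonaConic, mul_pow, ← pow_mul] at h1
    simp only [map_mul, map_pow, eval_C, eval_linForm]
    simp only [frameCoord, Matrix.cons_val] at h1
    linear_combination h1
  have hne : (Δ ^ 2) ^ n * D ^ n ≠ 0 :=
    mul_ne_zero (pow_ne_zero _ (pow_ne_zero _ hp)) (pow_ne_zero _ hQQ')
  refine ⟨((Δ ^ 2) ^ n * D ^ n)⁻¹ * g, ?_⟩
  rw [C_mul, mul_assoc, ← hFC, ← mul_assoc, ← C_mul, inv_mul_cancel₀ hne, C_1, one_mul]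

end Conic

/-- Let `k ≥ 3` and let `P₁, …, P₅` be five general points of `ℙ²` over
an infinite field, with homogeneous ideals `℘₁, …, ℘₅`.  Then the space
`[℘₁^{k-1} ∩ ⋯ ∩ ℘₅^{k-1}]_{2k-2}` of forms of degree `2k-2` vanishing to order at least
`k-1` at each of the five points is 1-dimensional. -/
theorem stmt19 (K : Type) [Field K] [Infinite K] (k : ℕ) (hk : 3 ≤ k) :
    GenericTuples K 5 (fun c =>
      Module.finrank K
        ↥(idealComp K (⨅ i : Fin 5, pointIdeal K (c i) ^ (k - 1)) (2 * k - 2)) = 1) := by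
  obtain ⟨n, rfl⟩ : ∃ n, k = n + 1 := ⟨k - 1, by omega⟩
  have hn : 2 * (n + 1) - 2 = 2 * n := by omega
  rw [GenericTuples, Nat.add_sub_cancel, hn]
  refine ⟨bracketProduct fun i t => X (i, t), ?_, fun c hc => ?_⟩
  · intro h
    obtain ⟨c, hc⟩ := exists_bracketProduct_ne_zero K
    have := map_bracketProduct (eval fun p : Fin 5 × Fin 3 => c p.1 p.2) fun i t => X (i, t)
    simp only [h, map_zero, eval_X] at this
    exact hc this.symm
  rw [map_bracketProduct] at hc
  simp only [eval_X] at hc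
  change bracketProduct c ≠ 0 at hc
  simp only [bracketProduct, ne_eq, mul_eq_zero, not_or, Finset.prod_eq_zero_iff, Finset.mem_univ,
    true_and, not_exists] at hc
  obtain ⟨⟨hp, h3, h4⟩, hD⟩ := hc
  set a := frameCoord (c 0) (c 1) (c 2) (c 3) with ha
  set b := frameCoord (c 0) (c 1) (c 2) (c 4) with hb
  have hinv : ∀ w : Fin 3 → K, (∀ i, w i ≠ 0) → ∀ i, cremonaInv w i ≠ 0 := by
    intro w hw i
    fin_cases i <;> simp [cremonaInv, hw]
  have hQQ' : (cremonaInv a ⨯₃ cremonaInv b) 2 ≠ 0 := by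
    have : (cremonaInv a ⨯₃ cremonaInv b) 2 = -(a 2 * b 2 * (a 0 * b 1 - a 1 * b 0)) := by
      simp [cremonaInv, cross_apply]
      ring
    rw [this]
    exact neg_ne_zero.mpr (mul_ne_zero (mul_ne_zero (h3 2) (h4 2)) hD)
  set S := cremonaConic K (c 0) (c 1) (c 2) (cremonaInv a) (cremonaInv b) with hS
  have hc0 : ∀ i, c i ≠ 0 := by
    intro i h
    fin_cases i
    · exact hp (by simp_all)
    · exact hp (by simp_all)
    · exact hp (by simp_all)
    · exact h3 0 (by simp_all [frameCoord])
    · exact h4 0 (by simp_all [frameCoord])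
  have hSc : ∀ i, eval (c i) S = 0 := by
    intro i
    rw [hS, eval_cremonaConic]
    have hl : ∀ u w : Fin 3 → K, (u ⨯₃ w) ⬝ᵥ u = 0 := fun u w => by
      rw [dotProduct_comm, dot_self_cross]
    have hr : ∀ u w : Fin 3 → K, (u ⨯₃ w) ⬝ᵥ w = 0 := fun u w => by
      rw [dotProduct_comm, dot_cross_self]
    fin_cases i
    · simp [cremonaInv, frameCoord, hl, hr]
    · simp [cremonaInv, frameCoord, hl, hr]
    · simp [cremonaInv, frameCoord, hl, hr]
    · exact hl _ _
    · exact hr _ _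
  have hS0 : S ^ n ≠ 0 := pow_ne_zero n (cremonaConic_ne_zero hp hQQ')
  have hSmem : S ^ n ∈ idealComp K (⨅ i : Fin 5, pointIdeal K (c i) ^ n) (2 * n) := by
    refine ⟨?_, isHomogeneous_cremonaConic.pow n⟩
    refine (Ideal.mem_iInf).mpr fun i => Ideal.pow_mem_pow ?_ n
    exact mem_pointIdeal_of_eval_eq_zero (hc0 i) isHomogeneous_cremonaConic (hSc i)
  refine (finrank_eq_one_iff_of_nonzero' (⟨S ^ n, hSmem⟩ :
    idealComp K (⨅ i : Fin 5, pointIdeal K (c i) ^ n) (2 * n))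
    (fun h => hS0 (congrArg Subtype.val h))).mpr ?_
  rintro ⟨F, hFI, hF⟩
  have hFi : ∀ i, F ∈ pointIdeal K (c i) ^ n := (Ideal.mem_iInf).mp hFI
  obtain ⟨r, hr⟩ := exists_eq_C_mul_cremonaConic_pow hF (hFi 0) (hFi 1) (hFi 2) (hFi 3) (hFi 4)
    hp rfl (hinv a h3) rfl (hinv b h4) hQQ'
  exact ⟨r, Subtype.ext ((smul_eq_C_mul _ r).trans hr.symm)⟩
end
end
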